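/- arXiv:1711.00175 — 2 statements merged into one kernel-verified Lean document; each statement's English description precedes it below -/
import Mathlib

section
/- Let n be odd, and let 1 ≤ s_1 < s_2 < … < s_k < n be integers with gcd(s_1,…,s_k,n) = 1. Let p be the number of odd elements among s_1,…,s_k and let r be the square-free part of 2p + 1. Then there exists a nonnegative integer a such that the number of spanning trees of the circulant graph C_{2n}(s_1,…,s_k,n) equals r · n · a². -/
open Polynomial Complex Finset
open scoped Classical

/-- The circulant graph `C_n(s 0, …, s (k-1))` on vertex set `ZMod n`:
`i` is adjacent to `i ± s j (mod n)` for each `j`. -/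
def circulant (n : ℕ) {k : ℕ} (s : Fin k → ℕ) : SimpleGraph (ZMod n) :=
  SimpleGraph.circulantGraph {x : ZMod n | ∃ j : Fin k, x = (s j : ZMod n)}

/-- The odd-valency circulant graph `C_{2n}(s 0, …, s (k-1), n)` on vertex set `ZMod (2n)`:
`i` is adjacent to `i ± s j (mod 2n)` for each `j`, and to `i + n (mod 2n)`. -/
def circulantOdd (n : ℕ) {k : ℕ} (s : Fin k → ℕ) : SimpleGraph (ZMod (2 * n)) :=
  SimpleGraph.circulantGraph
    ({x : ZMod (2 * n) | ∃ j : Fin k, x = (s j : ZMod (2 * n))} ∪ {(n : ZMod (2 * n))})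

/-- The number of spanning trees of `G`: the number of subgraphs of `G` (on the same
vertex set) that are trees. -/
noncomputable def numSpanningTrees {V : Type*} (G : SimpleGraph V) : ℕ :=
  Set.ncard {H : SimpleGraph V | H ≤ G ∧ H.IsTree}

/-! ### Rooted parent maps -/

/-- `f` fixes `ρ` and every vertex is sent to `ρ` by some iterate of `f`. -/
def IsRootedMap {V : Type*} (ρ : V) (f : V → V) : Prop :=
  f ρ = ρ ∧ ∀ i, ∃ m : ℕ, f^[m] i = ρ

/-- The graph joining every vertex to its image under `f`. -/
def parentGraph {V : Type*} (f : V → V) : SimpleGraph V :=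
  SimpleGraph.fromRel fun i j => f i = j

theorem IsRootedMap.exists_rank {V : Type*} {ρ : V} {f : V → V} (hf : IsRootedMap ρ f) :
    ∃ h : V → ℕ, ∀ i, i ≠ ρ → h (f i) < h i := by
  refine ⟨fun i => Nat.find (hf.2 i), fun i hi => ?_⟩
  obtain ⟨m, hm⟩ : ∃ m, Nat.find (hf.2 i) = m + 1 := by
    refine Nat.exists_eq_succ_of_ne_zero fun h0 => hi ?_
    simpa [h0] using Nat.find_spec (hf.2 i)
  have h := Nat.find_spec (hf.2 i)
  rw [hm, Function.iterate_succ_apply] at h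
  have := Nat.find_min' (hf.2 (f i)) h
  change Nat.find (hf.2 (f i)) < Nat.find (hf.2 i)
  omega

theorem isRootedMap_of_rank {V : Type*} {ρ : V} {f : V → V} (hρ : f ρ = ρ) (h : V → ℕ)
    (hh : ∀ i, i ≠ ρ → h (f i) < h i) : IsRootedMap ρ f := by
  refine ⟨hρ, fun i => ?_⟩
  induction hi : h i using Nat.strong_induction_on generalizing i with
  | _ k ih =>
    by_cases hiρ : i = ρ
    · exact ⟨0, hiρ⟩
    · obtain ⟨m, hm⟩ := ih _ (hi ▸ hh i hiρ) (f i) rfl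
      exact ⟨m + 1, hm⟩

theorem IsRootedMap.connected_parentGraph {V : Type*} {ρ : V} {f : V → V}
    (hf : IsRootedMap ρ f) : (parentGraph f).Connected := by
  have key : ∀ (m : ℕ) (i : V), f^[m] i = ρ → (parentGraph f).Reachable i ρ := by
    intro m
    induction m with
    | zero => rintro i rfl; exact SimpleGraph.Reachable.refl _
    | succ m ih =>
      intro i hi
      by_cases hfi : f i = i
      · exact ih i (by rwa [Function.iterate_succ_apply, hfi] at hi)
      · exact SimpleGraph.Reachable.trans
          (SimpleGraph.Adj.reachable ⟨fun h => hfi h.symm, Or.inl rfl⟩) (ih (f i) hi)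
  have : Nonempty V := ⟨ρ⟩
  refine ⟨fun i j => ?_⟩
  obtain ⟨a, ha⟩ := hf.2 i
  obtain ⟨b, hb⟩ := hf.2 j
  exact (key a i ha).trans (key b j hb).symm

theorem IsRootedMap.isTree_parentGraph {V : Type*} [Fintype V] {ρ : V} {f : V → V}
    (hf : IsRootedMap ρ f) : (parentGraph f).IsTree := by
  rw [SimpleGraph.isTree_iff_connected_and_card]
  refine ⟨hf.connected_parentGraph, ?_⟩
  have h1 := hf.connected_parentGraph.card_vert_le_card_edgeSet_add_one
  have h2 : Nat.card (parentGraph f).edgeSet ≤ Fintype.card V - 1 := by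
    have hsub : (parentGraph f).edgeSet ⊆
        ((univ.erase ρ).image fun i => s(i, f i) : Finset (Sym2 V)) := by
      intro e
      induction e with
      | _ a b =>
        simp only [SimpleGraph.mem_edgeSet, coe_image, Set.mem_image, Finset.mem_coe, mem_erase,
          mem_univ, and_true]
        rintro ⟨hab, h | h⟩
        · exact ⟨a, fun h' => hab (by rw [← h, h', hf.1]), by rw [h]⟩
        · exact ⟨b, fun h' => hab (by rw [← h, h', hf.1]), by rw [h, Sym2.eq_swap]⟩
    have h3 := Set.ncard_le_ncard hsub (Finset.finite_toSet _)
    rw [Set.ncard_coe_finset] at h3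
    rw [Nat.card_coe_set_eq]
    refine h3.trans (card_image_le.trans ?_)
    rw [card_erase_of_mem (mem_univ _), card_univ]
  have h4 : 0 < Fintype.card V := Fintype.card_pos_iff.2 ⟨ρ⟩
  rw [Nat.card_eq_fintype_card (α := V)] at *
  omega

theorem IsRootedMap.eq_of_parentGraph_eq {V : Type*} {ρ : V} {f g : V → V}
    (hf : IsRootedMap ρ f) (hg : IsRootedMap ρ g) (h : parentGraph f = parentGraph g) :
    f = g := by
  obtain ⟨r, hr⟩ := hf.exists_rank
  obtain ⟨q, hq⟩ := hg.exists_rank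
  have key : ∀ i, f i ≠ g i → f (f i) ≠ g (f i) := by
    intro i hi
    have hiρ : i ≠ ρ := fun h' => hi (by rw [h', hf.1, hg.1])
    have hadj : (parentGraph f).Adj i (f i) :=
      ⟨fun h' => (hr i hiρ).ne (by rw [← h']), Or.inl rfl⟩
    rw [h] at hadj
    have hgi : g (f i) = i := hadj.2.resolve_left fun h' => hi h'.symm
    rw [hgi]
    intro hffi
    have hfiρ : f i ≠ ρ := fun h' => hiρ (by rw [← hgi, h', hg.1])
    have h1 := hr i hiρ
    have h2 := hr (f i) hfiρ
    rw [hffi] at h2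
    omega
  funext i
  by_contra hi
  have hit : ∀ m : ℕ, f (f^[m] i) ≠ g (f^[m] i) := by
    intro m
    induction m with
    | zero => exact hi
    | succ m ih => rw [Function.iterate_succ_apply']; exact key _ ih
  obtain ⟨m, hm⟩ := hf.2 i
  exact hit m (by rw [hm, hf.1, hg.1])

theorem exists_isRootedMap_of_isTree {V : Type*} [Fintype V] (ρ : V) {T : SimpleGraph V}
    (hT : T.IsTree) : ∃ f : V → V, IsRootedMap ρ f ∧ parentGraph f = T := by
  have hstep : ∀ i, ∃ j, (i = ρ → j = ρ) ∧ (i ≠ ρ → T.Adj i j ∧ T.dist j ρ < T.dist i ρ) := by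
    intro i
    by_cases hi : i = ρ
    · exact ⟨ρ, fun _ => rfl, fun h => (h hi).elim⟩
    · obtain ⟨w, hw⟩ := hT.connected.exists_walk_length_eq_dist i ρ
      cases w with
      | nil => exact (hi rfl).elim
      | cons hadj w' =>
        refine ⟨_, fun h => (hi h).elim, fun _ => ⟨hadj, ?_⟩⟩
        have := SimpleGraph.dist_le w'
        rw [SimpleGraph.Walk.length_cons] at hw
        omega
  choose f hf1 hf2 using hstep
  have hf : IsRootedMap ρ f :=
    isRootedMap_of_rank (hf1 ρ rfl) (fun i => T.dist i ρ) fun i hi => (hf2 i hi).2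
  refine ⟨f, hf, ?_⟩
  have hle : parentGraph f ≤ T := by
    rintro a b ⟨hab, h | h⟩
    · rw [← h]
      exact (hf2 a fun h' => hab (by rw [← h, hf1 a h', h'])).1
    · rw [← h]
      exact (hf2 b fun h' => hab (by rw [← h, hf1 b h', h'])).1.symm
  exact le_antisymm hle
    ((SimpleGraph.isTree_iff_minimal_connected.1 hT).2 hf.connected_parentGraph hle)

theorem parentGraph_le_iff {V : Type*} {ρ : V} {f : V → V} (hf : IsRootedMap ρ f)
    (G : SimpleGraph V) : parentGraph f ≤ G ↔ ∀ i, i ≠ ρ → G.Adj i (f i) := by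
  constructor
  · intro h i hi
    obtain ⟨r, hr⟩ := hf.exists_rank
    exact h ⟨fun h' => (hr i hi).ne (by rw [← h']), Or.inl rfl⟩
  · rintro h a b ⟨hab, h' | h'⟩
    · rw [← h']
      exact h a fun h'' => hab (by rw [← h', h'', hf.1])
    · rw [← h']
      exact (h b fun h'' => hab (by rw [← h', h'', hf.1])).symm

theorem numSpanningTrees_eq_card {V : Type*} [Fintype V] [DecidableEq V] (ρ : V)
    (G : SimpleGraph V) :
    numSpanningTrees G =
      #{f : V → V | IsRootedMap ρ f ∧ ∀ i, i ≠ ρ → G.Adj i (f i)} := by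
  rw [numSpanningTrees, ← Set.ncard_coe_finset]
  refine (Set.ncard_congr (fun f _ => parentGraph f) ?_ ?_ ?_).symm
  · intro f hf
    simp only [coe_filter, mem_univ, true_and, Set.mem_ofPred_eq] at hf
    exact ⟨(parentGraph_le_iff hf.1 G).2 hf.2, hf.1.isTree_parentGraph⟩
  · intro f g hf hg h
    simp only [coe_filter, mem_univ, true_and, Set.mem_ofPred_eq] at hf hg
    exact hf.1.eq_of_parentGraph_eq hg.1 h
  · rintro T ⟨hle, hT⟩
    obtain ⟨f, hf, rfl⟩ := exists_isRootedMap_of_isTree ρ hT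
    exact ⟨f, by simpa using ⟨hf, (parentGraph_le_iff hf G).1 hle⟩, rfl⟩

/-! ### The matrix-tree theorem -/

/-- The matrix with row `e_ρ` at `ρ` and row `e_i - e_{f i}` at `i ≠ ρ`. -/
noncomputable def parentMatrix {V : Type*} [DecidableEq V] (R : Type*) [CommRing R] (ρ : V)
    (f : V → V) : Matrix V V R :=
  Matrix.of fun i => if i = ρ then Pi.single ρ 1 else Pi.single i 1 - Pi.single (f i) 1

theorem det_parentMatrix_of_isRootedMap {V : Type*} [Fintype V] [DecidableEq V] (R : Type*)
    [CommRing R] {ρ : V} {f : V → V} (hf : IsRootedMap ρ f) :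
    (parentMatrix R ρ f).det = 1 := by
  obtain ⟨r, hr⟩ := hf.exists_rank
  have hent : ∀ i j, r i ≤ r j → i ≠ j → parentMatrix R ρ f i j = 0 := by
    intro i j hij hne
    by_cases hi : i = ρ
    · subst hi
      simp [parentMatrix, hne.symm]
    · have : j ≠ f i := fun h => by
        have := hr i hi
        rw [← h] at this
        omega
      simp [parentMatrix, hi, hne.symm, this]
  have hdiag : ∀ i, parentMatrix R ρ f i i = 1 := by
    intro i
    by_cases hi : i = ρ
    · subst hi
      simp [parentMatrix]
    · have : i ≠ f i := fun h => (hr i hi).ne (by rw [← h])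
      simp [parentMatrix, hi, this]
  have htri : (parentMatrix R ρ f).BlockTriangular (fun i => OrderDual.toDual (r i)) := by
    intro i j hij
    refine hent i j (le_of_lt hij) ?_
    rintro rfl
    exact lt_irrefl _ hij
  rw [htri.det]
  refine prod_eq_one fun a _ => ?_
  have : (parentMatrix R ρ f).toSquareBlock (fun i => OrderDual.toDual (r i)) a = 1 := by
    ext ⟨i, hi⟩ ⟨j, hj⟩
    rw [Matrix.toSquareBlock_def, Matrix.of_apply]
    by_cases h : i = j
    · subst h
      simp [hdiag]
    · rw [hent i j (OrderDual.toDual.injective (hi.trans hj.symm)).le h,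
        Matrix.one_apply_ne (by simpa using h)]
  rw [this, Matrix.det_one]

theorem det_parentMatrix_of_not_isRootedMap {V : Type*} [Fintype V] [DecidableEq V] (R : Type*)
    [CommRing R] [IsDomain R] {ρ : V} {f : V → V} (hρ : f ρ = ρ) (hf : ¬ IsRootedMap ρ f) :
    (parentMatrix R ρ f).det = 0 := by
  rw [← Matrix.exists_mulVec_eq_zero_iff]
  refine ⟨fun i => if ∃ m : ℕ, f^[m] i = ρ then 0 else 1, fun h0 => hf ⟨hρ, fun i => ?_⟩, ?_⟩
  · have := congrFun h0 i
    by_contra hi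
    simp [hi] at this
  · have hiff : ∀ i, (∃ m : ℕ, f^[m] (f i) = ρ) ↔ ∃ m : ℕ, f^[m] i = ρ := by
      refine fun i => ⟨fun ⟨m, hm⟩ => ⟨m + 1, hm⟩, fun ⟨m, hm⟩ => ⟨m, ?_⟩⟩
      rw [← Function.iterate_succ_apply, Function.iterate_succ_apply', hm, hρ]
    funext i
    by_cases hi : i = ρ
    · have : ∃ m : ℕ, f^[m] ρ = ρ := ⟨0, rfl⟩
      simp [Matrix.mulVec, parentMatrix, hi, this]
    · have hrow : parentMatrix R ρ f i = Pi.single i 1 - Pi.single (f i) 1 := by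
        funext j
        simp [parentMatrix, hi]
      rw [Matrix.mulVec, hrow, sub_dotProduct]
      simp [hiff]

/-- The Laplacian matrix of `G` with the row at `ρ` replaced by `e_ρ`. -/
noncomputable def rootedLaplacian {V : Type*} [Fintype V] [DecidableEq V] (R : Type*) [CommRing R]
    (G : SimpleGraph V) (ρ : V) : Matrix V V R :=
  (G.lapMatrix R).updateRow ρ (Pi.single ρ 1)

theorem lapMatrix_row_eq_sum {V : Type*} [Fintype V] [DecidableEq V] (R : Type*) [CommRing R]
    (G : SimpleGraph V) (i : V) :
    G.lapMatrix R i = ∑ j, if G.Adj i j then (Pi.single i 1 - Pi.single j 1 : V → R) else 0 := by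
  funext l
  have h : ∀ j, (if G.Adj i j then (Pi.single i 1 - Pi.single j 1 : V → R) else 0) l =
      (if G.Adj i j then (if l = i then 1 else 0) else 0) -
        (if j = l then (if G.Adj i l then 1 else 0) else 0) := by
    intro j
    by_cases hj : j = l
    · subst hj
      by_cases ha : G.Adj i j <;> simp [ha, Pi.single_apply]
    · by_cases ha : G.Adj i j <;> simp [ha, Pi.single_apply, hj, Ne.symm hj]
  rw [Finset.sum_apply, sum_congr rfl fun j _ => h j, sum_sub_distrib]
  by_cases hl : l = i
  · subst hl
    simp [SimpleGraph.lapMatrix, SimpleGraph.degMatrix, SimpleGraph.degree,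
      SimpleGraph.neighborFinset_eq_filter]
  · simp [SimpleGraph.lapMatrix, SimpleGraph.degMatrix, hl, Ne.symm hl, SimpleGraph.adjMatrix_apply]

/-- The matrix-tree theorem. -/
theorem det_rootedLaplacian {V : Type*} [Fintype V] [DecidableEq V] (R : Type*) [CommRing R]
    [IsDomain R] (G : SimpleGraph V) (ρ : V) :
    (rootedLaplacian R G ρ).det = numSpanningTrees G := by
  set v : V → V → V → R := fun i j =>
    if i = ρ then (if j = ρ then Pi.single ρ 1 else 0)
    else (if G.Adj i j then Pi.single i 1 - Pi.single j 1 else 0) with hv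
  have hrows : rootedLaplacian R G ρ = Matrix.of fun i => ∑ j, v i j := by
    ext i j
    by_cases hi : i = ρ
    · subst hi
      simp [rootedLaplacian, hv]
    · rw [rootedLaplacian, Matrix.updateRow_ne hi, lapMatrix_row_eq_sum]
      simp [hv, hi]
  have hexp : (rootedLaplacian R G ρ).det = ∑ f : V → V, (Matrix.of fun i => v i (f i)).det := by
    rw [hrows]
    exact (Matrix.detRowAlternating (R := R) (n := V)).toMultilinearMap.map_sum v
  have hterm : ∀ f : V → V, (Matrix.of fun i => v i (f i)).det =
      if IsRootedMap ρ f ∧ ∀ i, i ≠ ρ → G.Adj i (f i) then 1 else 0 := by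
    intro f
    by_cases hρ : f ρ = ρ
    · by_cases hadj : ∀ i, i ≠ ρ → G.Adj i (f i)
      · have hM : (Matrix.of fun i => v i (f i)) = parentMatrix R ρ f := by
          ext i j
          by_cases hi : i = ρ
          · subst hi
            simp [hv, parentMatrix, hρ]
          · simp [hv, parentMatrix, hi, hadj i hi]
        rw [hM]
        by_cases hf : IsRootedMap ρ f
        · rw [det_parentMatrix_of_isRootedMap R hf, if_pos ⟨hf, hadj⟩]
        · rw [det_parentMatrix_of_not_isRootedMap R hρ hf, if_neg fun h => hf h.1]
      · rw [if_neg fun h => hadj h.2]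
        push Not at hadj
        obtain ⟨i, hi, hna⟩ := hadj
        exact Matrix.det_eq_zero_of_row_eq_zero i fun j => by simp [hv, hi, hna]
    · rw [if_neg fun h => hρ h.1.1]
      exact Matrix.det_eq_zero_of_row_eq_zero ρ fun j => by simp [hv, hρ]
  rw [hexp, sum_congr rfl fun f _ => hterm f, numSpanningTrees_eq_card ρ G, card_filter]
  push_cast
  rfl

theorem det_updateRow_lapMatrix {V : Type*} [Fintype V] [DecidableEq V] (R : Type*) [CommRing R]
    [IsDomain R] (G : SimpleGraph V) (ρ : V) (w : V → R) :
    ((G.lapMatrix R).updateRow ρ w).det = (∑ i, w i) * numSpanningTrees G := by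
  have h0 : ((G.lapMatrix R).updateRow ρ (w - (∑ i, w i) • Pi.single ρ 1)).det = 0 := by
    rw [← Matrix.exists_mulVec_eq_zero_iff]
    refine ⟨fun _ => 1, fun h => one_ne_zero (congrFun h ρ), ?_⟩
    funext i
    by_cases hi : i = ρ
    · subst hi
      simp [Matrix.mulVec, dotProduct, Pi.single_apply]
    · have := congrFun (G.lapMatrix_mulVec_const_eq_zero (R := R)) i
      simpa [Matrix.mulVec, hi] using this
  have h1 : w = (w - (∑ i, w i) • Pi.single ρ 1) + (∑ i, w i) • Pi.single ρ 1 := by simp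
  conv_lhs => rw [h1]
  rw [Matrix.det_updateRow_add, h0, Matrix.det_updateRow_smul, zero_add]
  rw [← det_rootedLaplacian R G ρ]
  rfl

/-- The rank-one perturbed form of the matrix-tree theorem. -/
theorem det_lapMatrix_add_one {K V : Type*} [Fintype V] [DecidableEq V] [Nonempty V] [Field K]
    [CharZero K] (G : SimpleGraph V) :
    (G.lapMatrix K + Matrix.of fun _ _ => 1).det =
      (Fintype.card V : K) ^ 2 * numSpanningTrees G := by
  obtain ⟨ρ⟩ := ‹Nonempty V›
  set N : K := (Fintype.card V : K) with hN
  have hN0 : N ≠ 0 := by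
    rw [hN, Nat.cast_ne_zero]
    exact (Fintype.card_pos_iff.2 ⟨ρ⟩).ne'
  set A : Matrix V V K := G.lapMatrix K + Matrix.of fun _ _ => 1 with hA
  have hcol : ∑ k, (1 : K) • A k = fun _ => N := by
    funext j
    have h := congrFun (G.lapMatrix_mulVec_const_eq_zero (R := K)) j
    have hs : ∑ k, G.lapMatrix K k j = 0 := by
      have hsymm : ∀ k, G.lapMatrix K k j = G.lapMatrix K j k :=
        fun k => (G.isSymm_lapMatrix (R := K)).apply j k
      rw [sum_congr rfl fun k _ => hsymm k]
      simpa [Matrix.mulVec, dotProduct] using h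
    have hentry : ∀ k, ((1 : K) • A k) j = G.lapMatrix K k j + 1 := fun k => by simp [hA]
    rw [Finset.sum_apply, sum_congr rfl fun k _ => hentry k, sum_add_distrib, hs]
    simp [hN]
  have h1 : A.det = (A.updateRow ρ fun _ => N).det := by
    have := Matrix.det_updateRow_sum A ρ fun _ => (1 : K)
    rw [hcol] at this
    simpa using this.symm
  rw [h1, sq, mul_assoc]
  have h2 : (A.updateRow ρ fun _ => N).det = ((G.lapMatrix K).updateRow ρ fun _ => N).det := by
    refine Matrix.det_eq_of_forall_row_eq_smul_add_const (fun i => if i = ρ then 0 else N⁻¹) ρ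
      (by simp) fun i j => ?_
    by_cases hi : i = ρ
    · simp [hi]
    · simp [hi, hA, hN0]
  rw [h2, det_updateRow_lapMatrix]
  simp [hN, mul_assoc]

/-! ### Spanning trees of Cayley graphs of cyclic groups -/

theorem det_circulant_eq_prod {N : ℕ} [NeZero N] {χ : AddChar (ZMod N) ℂ} (hχ : χ.IsPrimitive)
    (v : ZMod N → ℂ) : (Matrix.circulant v).det = ∏ j, ∑ m, v m * χ (m * j) := by
  set F : Matrix (ZMod N) (ZMod N) ℂ := Matrix.of fun j i => χ (i * j) with hF
  set F' : Matrix (ZMod N) (ZMod N) ℂ := Matrix.of fun i l => χ (-(i * l)) with hF'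
  have hinv : F * F' = (N : ℂ) • (1 : Matrix (ZMod N) (ZMod N) ℂ) := by
    ext j l
    have h : ∀ i, F j i * F' i l = χ (i * (j - l)) := by
      intro i
      simp only [hF, hF', Matrix.of_apply]
      rw [← AddChar.map_add_eq_mul]
      congr 1
      ring
    rw [Matrix.mul_apply, sum_congr rfl fun i _ => h i, AddChar.sum_mulShift _ hχ]
    by_cases hjl : j = l
    · simp [hjl, ZMod.card]
    · simp [hjl, sub_eq_zero]
  have hdet : F.det ≠ 0 := by
    intro h0
    have h := congrArg Matrix.det hinv
    rw [Matrix.det_mul, h0, zero_mul, Matrix.det_smul, Matrix.det_one, mul_one] at h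
    exact pow_ne_zero _ (Nat.cast_ne_zero.2 (NeZero.ne N)) h.symm
  have hconj : F * Matrix.circulant v =
      Matrix.diagonal (fun j => ∑ m, v m * χ (m * j)) * F := by
    ext j l
    rw [Matrix.diagonal_mul, Matrix.mul_apply, sum_mul, ← Equiv.sum_comp (Equiv.addRight l)]
    refine sum_congr rfl fun m _ => ?_
    simp only [hF, Matrix.of_apply, Matrix.circulant_apply, Equiv.coe_addRight,
      add_sub_cancel_right, add_mul, AddChar.map_add_eq_mul]
    ring
  have h := congrArg Matrix.det hconj
  rw [Matrix.det_mul, Matrix.det_mul, Matrix.det_diagonal, mul_comm] at h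
  exact mul_right_cancel₀ hdet h

theorem card_mul_numSpanningTrees_eq_prod {N : ℕ} [NeZero N] {χ : AddChar (ZMod N) ℂ}
    (hχ : χ.IsPrimitive) (S : Finset (ZMod N)) (hS0 : (0 : ZMod N) ∉ S) (G : SimpleGraph (ZMod N))
    (hG : ∀ i j, G.Adj i j ↔ i - j ∈ S) :
    (N : ℂ) * numSpanningTrees G = ∏ j ∈ univ.erase 0, ∑ m ∈ S, (1 - χ (m * j)) := by
  set v : ZMod N → ℂ := fun m =>
    (if m = 0 then (#S : ℂ) else 0) - (if m ∈ S then 1 else 0) + 1 with hv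
  have hdeg : ∀ i, G.degree i = #S := by
    intro i
    rw [← SimpleGraph.card_neighborFinset_eq_degree]
    refine card_bij' (fun j _ => i - j) (fun m _ => i - m) ?_ ?_ ?_ ?_ <;> simp [hG]
  have hmat : G.lapMatrix ℂ + Matrix.of (fun _ _ => 1) = Matrix.circulant v := by
    ext i j
    by_cases hij : i = j
    · subst hij
      simp [hv, SimpleGraph.lapMatrix, SimpleGraph.degMatrix, hdeg, hS0]
    · simp [hv, SimpleGraph.lapMatrix, SimpleGraph.degMatrix, hij, hG, sub_eq_zero,
        SimpleGraph.adjMatrix_apply]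
  have heig : ∀ j, ∑ m, v m * χ (m * j) =
      ∑ m ∈ S, (1 - χ (m * j)) + if j = 0 then (N : ℂ) else 0 := by
    intro j
    have h := AddChar.sum_mulShift j hχ
    rw [ZMod.card] at h
    simp only [hv, add_mul, sub_mul, sum_add_distrib, sum_sub_distrib, one_mul, h, ite_mul,
      zero_mul]
    simp
  have hdet := det_lapMatrix_add_one (K := ℂ) G
  rw [hmat, det_circulant_eq_prod hχ, ZMod.card, ← mul_prod_erase univ _ (mem_univ 0),
    heig 0] at hdet
  have hN : (N : ℂ) ≠ 0 := Nat.cast_ne_zero.2 (NeZero.ne N)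
  apply mul_left_cancel₀ hN
  rw [← mul_assoc, ← sq, ← hdet]
  congr 1
  · simp
  · refine prod_congr rfl fun j hj => ?_
    rw [heig j, if_neg (ne_of_mem_erase hj), add_zero]

/-! ### Rationality and integrality of the half product -/

theorem exists_rat_prod_eval_cos (F : ℚ[X]) (m : ℕ) :
    ∃ q : ℚ, ∏ k ∈ range m,
      (F.map (algebraMap ℚ ℝ)).eval (Real.cos ((k + 1) * Real.pi / (m + 1))) = q := by
  have hroots := Chebyshev.roots_U_real m
  have hinj := (Finset.range m).nodup_map_iff_injOn.mp (Chebyshev.roots_U_real_nodup m)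
  have hsplit : (Chebyshev.U ℝ m).Splits := by
    rw [splits_iff_card_roots, hroots, card_val, card_image_of_injOn hinj, card_range,
      Chebyshev.natDegree_U_natCast]
  have hres := resultant_eq_prod_eval (Chebyshev.U ℝ m) (F.map (algebraMap ℚ ℝ)) F.natDegree
    natDegree_map_le hsplit
  have hprod : ((Chebyshev.U ℝ m).roots.map (F.map (algebraMap ℚ ℝ)).eval).prod =
      ∏ k ∈ range m,
        (F.map (algebraMap ℚ ℝ)).eval (Real.cos ((k + 1) * Real.pi / (m + 1))) := by
    rw [hroots, ← prod_image (f := (F.map (algebraMap ℚ ℝ)).eval) hinj]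
    rfl
  rw [hprod, Chebyshev.leadingCoeff_U_natCast, Chebyshev.natDegree_U_natCast,
    ← Chebyshev.map_U (algebraMap ℚ ℝ), resultant_map_map] at hres
  refine ⟨resultant (Chebyshev.U ℚ m) F m F.natDegree / (2 ^ m) ^ F.natDegree, ?_⟩
  push_cast
  rw [eq_div_iff (by positivity), mul_comm, ← hres]
  rfl

/-- The Laplacian eigenvalue of `C_{2n}(s_1, …, s_k, n)` at the root of unity `z`. -/
noncomputable def circulantOddEigenvalue (n : ℕ) {k : ℕ} (s : Fin k → ℕ) (z : ℂ) : ℂ :=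
  ∑ i, (1 - z ^ s i) * (1 - z⁻¹ ^ s i) + (1 - z ^ n)

theorem circulantOddEigenvalue_inv (n : ℕ) {k : ℕ} (s : Fin k → ℕ) {z : ℂ} (hz : z ^ (2 * n) = 1) :
    circulantOddEigenvalue n s z⁻¹ = circulantOddEigenvalue n s z := by
  have h : z⁻¹ ^ n = z ^ n := by
    rw [inv_pow]
    exact inv_eq_of_mul_eq_one_left (by rw [← pow_add, ← two_mul, hz])
  simp only [circulantOddEigenvalue, inv_inv, h, mul_comm]

theorem circulantOddEigenvalue_exp (n : ℕ) {k : ℕ} (s : Fin k → ℕ) (θ : ℝ)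
    (hz : exp (θ * I) ^ (2 * n) = 1) :
    circulantOddEigenvalue n s (exp (θ * I)) =
      (((∑ i, (2 - 2 * Chebyshev.T ℚ (s i)) + (1 - Chebyshev.T ℚ n)).map
        (algebraMap ℚ ℝ)).eval (Real.cos θ) : ℝ) := by
  have hcos : ∀ t : ℕ, (Real.cos (t * θ) : ℂ) = (exp (θ * I) ^ t + (exp (θ * I))⁻¹ ^ t) / 2 := by
    intro t
    rw [← exp_neg, ← exp_nat_mul, ← exp_nat_mul, ofReal_cos, Complex.cos]
    push_cast
    ring_nf
  have hn : (exp (θ * I))⁻¹ ^ n = exp (θ * I) ^ n := by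
    rw [inv_pow]
    exact inv_eq_of_mul_eq_one_left (by rw [← pow_add, ← two_mul, hz])
  have hone : ∀ t : ℕ, exp (θ * I) ^ t * (exp (θ * I))⁻¹ ^ t = 1 := by
    intro t
    rw [← mul_pow, mul_inv_cancel₀ (exp_ne_zero _), one_pow]
  simp only [Polynomial.map_add, Polynomial.map_sub, Polynomial.map_mul, Polynomial.map_sum,
    Polynomial.map_one, Polynomial.map_ofNat, Chebyshev.map_T, eval_add, eval_sub, eval_mul,
    eval_finsetSum, eval_one, eval_ofNat, Chebyshev.T_real_cos, Int.cast_natCast]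
  push_cast
  simp only [← ofReal_natCast, ← ofReal_mul, ← ofReal_cos]
  simp only [hcos, hn, circulantOddEigenvalue]
  congr 1
  · refine sum_congr rfl fun i _ => ?_
    linear_combination hone (s i)
  · ring

theorem prod_range_two_mul {M : Type*} [CommMonoid M] (f : ℕ → M) (h : ℕ) :
    ∏ k ∈ range (2 * h), f k = ∏ i ∈ range h, f (2 * i) * f (2 * i + 1) := by
  induction h with
  | zero => simp
  | succ h ih => rw [mul_add, mul_one, prod_range_succ, prod_range_succ, prod_range_succ, ih,
      mul_assoc]

theorem prod_half_one_sub_pow_mul_inv {h : ℕ} {ζ : ℂ} (hζ : IsPrimitiveRoot ζ (2 * h + 1)) :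
    ∏ i ∈ range h, ((1 - ζ ^ (i + 1)) * (1 - (ζ ^ (i + 1))⁻¹)) = (2 * h + 1 : ℕ) := by
  have h1 := hζ.prod_one_sub_pow_eq_order
  rw [two_mul, prod_range_add, ← prod_range_reflect (fun i => 1 - ζ ^ (h + i + 1)),
    ← prod_mul_distrib] at h1
  push_cast at h1 ⊢
  rw [two_mul, ← h1]
  refine prod_congr rfl fun i hi => ?_
  rw [mem_range] at hi
  congr 2
  refine inv_eq_of_mul_eq_one_left ?_
  rw [← pow_add, ← hζ.pow_eq_one]
  congr 1
  omega

theorem circulantOddEigenvalue_eq_mul (n : ℕ) {k : ℕ} (s : Fin k → ℕ) {z : ℂ} (hz : z ^ n = 1) :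
    circulantOddEigenvalue n s z = (1 - z) * (1 - z⁻¹) *
      ∑ i, (∑ a ∈ range (s i), z ^ a) * ∑ a ∈ range (s i), z⁻¹ ^ a := by
  rw [circulantOddEigenvalue, hz, sub_self, add_zero, mul_sum]
  refine sum_congr rfl fun i _ => ?_
  rw [← mul_neg_geom_sum, ← mul_neg_geom_sum]
  ring

theorem isIntegral_circulantOddEigenvalue (n : ℕ) {k : ℕ} (s : Fin k → ℕ) {z : ℂ}
    (hz : IsIntegral ℤ z) (hz' : IsIntegral ℤ z⁻¹) :
    IsIntegral ℤ (circulantOddEigenvalue n s z) :=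
  (IsIntegral.sum _ fun _ _ => (isIntegral_one.sub (hz.pow _)).mul
    (isIntegral_one.sub (hz'.pow _))).add (isIntegral_one.sub (hz.pow _))

theorem exists_int_half_prod (h : ℕ) {k : ℕ} (s : Fin k → ℕ) :
    ∃ c : ℤ, ∏ j ∈ range (2 * h), circulantOddEigenvalue (2 * h + 1) s
      (exp (2 * Real.pi * I / (2 * (2 * h + 1) : ℕ)) ^ (j + 1)) = (2 * h + 1 : ℕ) * (c : ℂ) := by
  set n := 2 * h + 1 with hn
  set ω := exp (2 * Real.pi * I / (2 * n : ℕ)) with hω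
  have hprim : IsPrimitiveRoot ω (2 * n) := isPrimitiveRoot_exp _ (by omega)
  have hζ : IsPrimitiveRoot (ω ^ 2) n := hprim.pow (by omega) rfl
  have hωint : ∀ j : ℕ, IsIntegral ℤ (ω ^ j) := fun j => (hprim.isIntegral (by omega)).pow j
  have hωint' : ∀ j : ℕ, IsIntegral ℤ (ω ^ j)⁻¹ := fun j => by
    rw [← inv_pow]
    exact (hprim.inv.isIntegral (by omega)).pow j
  obtain ⟨q, hq⟩ : ∃ q : ℚ, ∏ j ∈ range (2 * h), circulantOddEigenvalue n s (ω ^ (j + 1)) = q := by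
    obtain ⟨q, hq⟩ := exists_rat_prod_eval_cos
      (∑ i, (2 - 2 * Chebyshev.T ℚ (s i)) + (1 - Chebyshev.T ℚ n)) (2 * h)
    refine ⟨q, ?_⟩
    rw [← ofReal_ratCast, ← hq, ofReal_prod]
    refine prod_congr rfl fun j _ => ?_
    have hexp : ω ^ (j + 1) = exp (((j + 1) * Real.pi / ((2 * h : ℕ) + 1) : ℝ) * I) := by
      rw [hω, ← exp_nat_mul, hn]
      congr 1
      push_cast
      have : (2 * (h : ℂ) + 1) ≠ 0 := by exact_mod_cast (by omega : 2 * h + 1 ≠ 0)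
      field_simp
    rw [hexp]
    refine circulantOddEigenvalue_exp n s _ ?_
    rw [← hexp, ← pow_mul, mul_comm, pow_mul, hprim.pow_eq_one, one_pow]
  obtain ⟨C, hC, hCprod⟩ : ∃ C : ℂ, IsIntegral ℤ C ∧
      ∏ j ∈ range (2 * h), circulantOddEigenvalue n s (ω ^ (j + 1)) = n * C := by
    have hev : ∀ i : ℕ, ω ^ (2 * i + 1 + 1) = (ω ^ 2) ^ (i + 1) := fun i => by
      rw [← pow_mul]
      rfl
    refine ⟨∏ i ∈ range h, (circulantOddEigenvalue n s (ω ^ (2 * i + 1)) *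
      ∑ l, (∑ a ∈ range (s l), (ω ^ (2 * i + 1 + 1)) ^ a) *
        ∑ a ∈ range (s l), (ω ^ (2 * i + 1 + 1))⁻¹ ^ a), ?_, ?_⟩
    · refine IsIntegral.prod _ fun i _ =>
        (isIntegral_circulantOddEigenvalue n s (hωint _) (hωint' _)).mul
          (IsIntegral.sum _ fun l _ => IsIntegral.mul ?_ ?_)
      · exact IsIntegral.sum _ fun a _ => (hωint _).pow a
      · exact IsIntegral.sum _ fun a _ => (hωint' _).pow a
    · rw [prod_range_two_mul, ← prod_half_one_sub_pow_mul_inv hζ, ← prod_mul_distrib]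
      refine prod_congr rfl fun i _ => ?_
      have hzn : (ω ^ (2 * i + 1 + 1)) ^ n = 1 := by
        rw [hev, ← pow_mul, mul_comm, pow_mul, hζ.pow_eq_one, one_pow]
      rw [circulantOddEigenvalue_eq_mul n s hzn, ← hev]
      ring
  have hn0 : (n : ℂ) ≠ 0 := by exact_mod_cast (by omega : n ≠ 0)
  have hCq : C = algebraMap ℚ ℂ (q / n) := by
    rw [hq] at hCprod
    rw [eq_ratCast]
    push_cast
    rw [hCprod]
    field_simp
  rw [hCq, isIntegral_algebraMap_iff (algebraMap ℚ ℂ).injective] at hC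
  obtain ⟨c, hc⟩ := IsIntegrallyClosed.isIntegral_iff.1 hC
  refine ⟨c, ?_⟩
  rw [hCprod, hCq, ← hc]
  simp

/-! ### The graph `C_{2n}(s_1, …, s_k, n)` -/

/-- The connection set of `C_{2n}(s_1, …, s_k, n)`. -/
noncomputable def connectionSet (n : ℕ) {k : ℕ} (s : Fin k → ℕ) : Finset (ZMod (2 * n)) :=
  insert (n : ZMod (2 * n)) (univ.image (fun i => (s i : ZMod (2 * n))) ∪
    univ.image fun i => -(s i : ZMod (2 * n)))

section

variable {n k : ℕ} {s : Fin k → ℕ}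

theorem natCast_zmod_inj_of_lt {N a b : ℕ} (ha : a < N) (hb : b < N)
    (h : (a : ZMod N) = (b : ZMod N)) : a = b := by
  rw [← ZMod.val_natCast_of_lt ha, ← ZMod.val_natCast_of_lt hb, h]

theorem neg_natCast_zmod {N a : ℕ} (ha : a ≤ N) : -(a : ZMod N) = ((N - a : ℕ) : ZMod N) := by
  rw [Nat.cast_sub ha, ZMod.natCast_self, zero_sub]

theorem neg_natCast_half (n : ℕ) : -(n : ZMod (2 * n)) = n := by
  rw [neg_natCast_zmod (by omega), two_mul, Nat.add_sub_cancel]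

theorem zero_notMem_connectionSet (h1 : ∀ j, 1 ≤ s j) (h2 : ∀ j, s j < n) (hn : 1 ≤ n) :
    (0 : ZMod (2 * n)) ∉ connectionSet n s := by
  have hne : ∀ a : ℕ, 1 ≤ a → a < 2 * n → (a : ZMod (2 * n)) ≠ 0 := by
    intro a ha1 ha2 h
    have := natCast_zmod_inj_of_lt ha2 (by omega : 0 < 2 * n) (by simpa using h)
    omega
  simp only [connectionSet, mem_insert, mem_union, mem_image, mem_univ, true_and, not_or,
    not_exists, neg_eq_zero]
  exact ⟨(hne n hn (by omega)).symm, fun i => hne _ (h1 i) (by have := h2 i; omega),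
    fun i => hne _ (h1 i) (by have := h2 i; omega)⟩

theorem circulantOdd_adj_iff (h1 : ∀ j, 1 ≤ s j) (h2 : ∀ j, s j < n) (hn : 1 ≤ n)
    (u v : ZMod (2 * n)) : (circulantOdd n s).Adj u v ↔ u - v ∈ connectionSet n s := by
  have hmem : u - v ∈ connectionSet n s ↔
      ((∃ j, u - v = s j) ∨ u - v = n) ∨ ((∃ j, v - u = s j) ∨ v - u = n) := by
    simp only [connectionSet, mem_insert, mem_union, mem_image, mem_univ, true_and,
      ← neg_sub u v, neg_eq_iff_eq_neg, neg_natCast_half, eq_comm (b := u - v)]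
    tauto
  simp only [circulantOdd, SimpleGraph.circulantGraph_adj, Set.mem_union, Set.mem_ofPred_eq,
    Set.mem_singleton_iff, ← hmem]
  refine ⟨fun h => h.2, fun h => ⟨?_, h⟩⟩
  rintro rfl
  rw [sub_self] at h
  exact zero_notMem_connectionSet h1 h2 hn h

theorem sum_connectionSet (hs : Function.Injective s) (h1 : ∀ j, 1 ≤ s j) (h2 : ∀ j, s j < n)
    (φ : ZMod (2 * n) → ℂ) : ∑ m ∈ connectionSet n s, φ m =
      φ n + (∑ i, φ (s i) + ∑ i, φ (-(s i : ZMod (2 * n)))) := by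
  have hcast : ∀ i j, (s i : ZMod (2 * n)) = s j → i = j := fun i j h =>
    hs (natCast_zmod_inj_of_lt (by have := h2 i; omega) (by have := h2 j; omega) h)
  rw [connectionSet, sum_insert, sum_union, sum_image fun i _ j _ h => hcast i j h,
    sum_image fun i _ j _ h => hcast i j (neg_injective h)]
  · rw [disjoint_left]
    simp only [mem_image, mem_univ, true_and, not_exists]
    rintro _ ⟨i, rfl⟩ j h
    have hi := h2 i
    have hj := h2 j
    rw [neg_natCast_zmod (by omega)] at h
    have h1j := h1 j
    have := natCast_zmod_inj_of_lt (by omega) (by omega) h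
    omega
  · have hne : ∀ i, (s i : ZMod (2 * n)) ≠ n := by
      intro i h
      have hi := h2 i
      have := natCast_zmod_inj_of_lt (by omega) (by omega) h
      omega
    simp only [mem_union, mem_image, mem_univ, true_and, not_or, not_exists]
    exact ⟨hne, fun i h => hne i (by rw [← neg_neg (s i : ZMod (2 * n)), h, neg_natCast_half])⟩

theorem numSpanningTrees_circulantOdd_eq_prod (hs : Function.Injective s) (h1 : ∀ j, 1 ≤ s j)
    (h2 : ∀ j, s j < n) (hn : 1 ≤ n) {ω : ℂ} (hω : IsPrimitiveRoot ω (2 * n)) :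
    ((2 * n : ℕ) : ℂ) * numSpanningTrees (circulantOdd n s) =
      ∏ j ∈ range (2 * n - 1), circulantOddEigenvalue n s (ω ^ (j + 1)) := by
  have : NeZero (2 * n) := ⟨by omega⟩
  rw [card_mul_numSpanningTrees_eq_prod (AddChar.zmodChar_primitive_of_primitive_root (2 * n) hω)
    (connectionSet n s) (zero_notMem_connectionSet h1 h2 hn) _ (circulantOdd_adj_iff h1 h2 hn)]
  symm
  refine prod_bij (fun j _ => ((j + 1 : ℕ) : ZMod (2 * n))) ?_ ?_ ?_ ?_
  · intro j hj
    rw [mem_range] at hj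
    refine mem_erase.2 ⟨fun h => ?_, mem_univ _⟩
    have := natCast_zmod_inj_of_lt (by omega : j + 1 < 2 * n) (by omega : 0 < 2 * n)
      (by simpa using h)
    omega
  · intro i hi j hj h
    rw [mem_range] at hi hj
    have := natCast_zmod_inj_of_lt (by omega) (by omega) h
    omega
  · intro b hb
    have hb0 : b.val ≠ 0 := by
      rw [Ne, ZMod.val_eq_zero]
      exact ne_of_mem_erase hb
    have hlt := ZMod.val_lt b
    refine ⟨b.val - 1, mem_range.2 (by omega), ?_⟩
    rw [Nat.sub_add_cancel (by omega), ZMod.natCast_zmod_val]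
  · intro j _
    have hχ : ∀ a : ℕ, AddChar.zmodChar (2 * n) hω.pow_eq_one
        ((a : ZMod (2 * n)) * ((j + 1 : ℕ) : ZMod (2 * n))) = (ω ^ (j + 1)) ^ a := by
      intro a
      rw [← Nat.cast_mul, AddChar.zmodChar_apply', mul_comm, pow_mul]
    rw [sum_connectionSet hs h1 h2]
    simp only [neg_mul, AddChar.map_neg_eq_inv, hχ]
    rw [circulantOddEigenvalue, add_comm, ← sum_add_distrib]
    congr 1
    refine sum_congr rfl fun i _ => ?_
    have hone : (ω ^ (j + 1)) ^ s i * ((ω ^ (j + 1)) ^ s i)⁻¹ = 1 :=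
      mul_inv_cancel₀ (pow_ne_zero _ (pow_ne_zero _ (hω.ne_zero (by omega))))
    rw [inv_pow]
    linear_combination hone

theorem circulantOddEigenvalue_neg_one (hodd : Odd n) :
    circulantOddEigenvalue n s (-1) = 2 * ((2 * #{j | Odd (s j)} + 1 : ℕ) : ℂ) := by
  have hterm : ∀ i, (1 - (-1 : ℂ) ^ s i) * (1 - (-1 : ℂ)⁻¹ ^ s i) =
      if Odd (s i) then 4 else 0 := by
    intro i
    by_cases h : Odd (s i)
    · rw [if_pos h, inv_neg_one, h.neg_one_pow]
      norm_num
    · rw [if_neg h, (Nat.not_odd_iff_even.1 h).neg_one_pow]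
      simp
  rw [circulantOddEigenvalue, sum_congr rfl fun i _ => hterm i, hodd.neg_one_pow, ← sum_filter,
    sum_const]
  push_cast
  rw [nsmul_eq_mul]
  ring

theorem prod_range_symm {M : Type*} [CommMonoid M] (m : ℕ) (f : ℕ → M)
    (hf : ∀ j < m, f (2 * m - j) = f j) :
    ∏ j ∈ range (2 * m + 1), f j = f m * (∏ j ∈ range m, f j) ^ 2 := by
  have h : ∏ j ∈ range m, f (m + 1 + j) = ∏ j ∈ range m, f j := by
    rw [← prod_range_reflect]
    refine prod_congr rfl fun j hj => ?_
    rw [mem_range] at hj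
    rw [← hf j hj]
    congr 1
    omega
  rw [show 2 * m + 1 = m + 1 + m by omega, prod_range_add, prod_range_succ, h, sq, mul_comm _ (f m),
    mul_assoc]

theorem exists_int_numSpanningTrees_circulantOdd (hodd : Odd n) (hs : Function.Injective s)
    (h1 : ∀ j, 1 ≤ s j) (h2 : ∀ j, s j < n) :
    ∃ c : ℤ, (numSpanningTrees (circulantOdd n s) : ℤ) =
      (2 * #{j | Odd (s j)} + 1 : ℕ) * n * c ^ 2 := by
  obtain ⟨h, rfl⟩ := hodd
  set n := 2 * h + 1 with hn
  obtain ⟨c, hc⟩ := exists_int_half_prod h s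
  rw [← hn] at hc
  set ω := exp (2 * Real.pi * I / (2 * n : ℕ)) with hω
  have hprim : IsPrimitiveRoot ω (2 * n) := isPrimitiveRoot_exp _ (by omega)
  have hpow : ∀ j : ℕ, (ω ^ j) ^ (2 * n) = 1 := fun j => by
    rw [← pow_mul, mul_comm, pow_mul, hprim.pow_eq_one, one_pow]
  have hhalf : ω ^ n = -1 :=
    (hprim.pow (by omega) (mul_comm 2 n)).eq_neg_one_of_two_right
  have hprod := numSpanningTrees_circulantOdd_eq_prod hs h1 h2 (by omega) hprim
  rw [show 2 * n - 1 = 2 * (2 * h) + 1 by omega, prod_range_symm, hc, ← hn, hhalf,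
    circulantOddEigenvalue_neg_one (hn ▸ odd_two_mul_add_one h)] at hprod
  · refine ⟨c, ?_⟩
    have hn0 : (2 * n : ℂ) ≠ 0 := by exact_mod_cast (by omega : 2 * n ≠ 0)
    have : (numSpanningTrees (circulantOdd n s) : ℂ) =
        (2 * #{j | Odd (s j)} + 1 : ℕ) * n * c ^ 2 := by
      apply mul_left_cancel₀ hn0
      push_cast at hprod ⊢
      rw [hprod]
      ring
    exact_mod_cast this
  · intro j hj
    rw [← circulantOddEigenvalue_inv n s (hpow (j + 1))]
    congr 1
    refine eq_inv_of_mul_eq_one_left ?_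
    rw [← pow_add, ← hprim.pow_eq_one]
    congr 1
    omega

end

/-- for odd `n`, if `p` is the number of odd elements among `s_1,…,s_k` and
`r` is the square-free part of `2p + 1` (i.e. `r` squarefree with `2p + 1 = r x²`, `x ≥ 1`),
then the number of spanning trees of `C_{2n}(s_1,…,s_k,n)` equals `r · n · a²` for some
integer `a`. -/
theorem statement13 (n k : ℕ) (hodd : Odd n) (hn : 1 ≤ n) (hk : 0 < k) (s : Fin k → ℕ)
    (hmono : StrictMono s) (h1 : ∀ j, 1 ≤ s j) (h2 : ∀ j, s j < n)
    (hgcd : Nat.gcd (Finset.univ.gcd s) n = 1)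
    (r x : ℕ) (hr : Squarefree r) (hx : 0 < x)
    (hprx : 2 * (Finset.univ.filter fun j => Odd (s j)).card + 1 = r * x ^ 2) :
    ∃ a : ℕ, numSpanningTrees (circulantOdd n s) = r * n * a ^ 2 := by
  obtain ⟨c, hc⟩ := exists_int_numSpanningTrees_circulantOdd hodd hmono.injective h1 h2
  refine ⟨x * c.natAbs, ?_⟩
  have h : (2 * #{j | Odd (s j)} + 1 : ℕ) = r * x ^ 2 := by
    convert hprx
  rw [h] at hc
  zify
  rw [hc, mul_pow, sq_abs]
  push_cast
  ring
end

section
/- Let n be even, and let 1 ≤ s_1 < s_2 < … < s_k < n be integers with gcd(s_1,…,s_k,n) = 1. Let p be the number of odd elements among s_1,…,s_k (so p ≥ 1) and let q be the square-free part of 2p. Then there exists a nonnegative integer a such that the number of spanning trees of the circulant graph C_{2n}(s_1,…,s_k,n) equals q · n · a². -/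
open Polynomial Complex Finset
open scoped Classical

namespace SpanningTree

variable {V : Type*}

/-- The row of the vertex `v` in the matrix of the oriented edge from `v` to `u`, rooted at `r`. -/
def edgeRow [DecidableEq V] (r v u : V) : V → ℤ :=
  if v = r then Pi.single r 1 else Pi.single v 1 - Pi.single u 1

/-- The parent map `φ` leads every vertex to the root `r`. -/
def LeadsTo (φ : V → V) (r : V) : Prop := ∀ v, ∃ t : ℕ, φ^[t] v = r

/-- The graph joining each vertex to its parent. -/
def parentGraph (φ : V → V) : SimpleGraph V := SimpleGraph.fromRel fun u v => φ u = v

theorem det_edgeRow_of_not_leadsTo [Fintype V] [DecidableEq V]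
    {φ : V → V} {r : V} (hr : φ r = r) (h : ¬ LeadsTo φ r) :
    Matrix.det (Matrix.of fun v => edgeRow r v (φ v)) = 0 := by
  unfold LeadsTo at h
  push Not at h
  obtain ⟨w, hw⟩ := h
  rw [← Matrix.exists_mulVec_eq_zero_iff]
  refine ⟨fun v => if ∃ t : ℕ, φ^[t] v = r then 0 else 1, fun h0 => ?_, ?_⟩
  · have := congrFun h0 w
    simp [hw] at this
  · ext v
    by_cases hv : v = r
    · subst hv
      have : ∃ t : ℕ, φ^[t] v = v := ⟨0, rfl⟩
      simp [Matrix.mulVec, edgeRow, this]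
    · have key : (∃ t : ℕ, φ^[t] v = r) ↔ ∃ t : ℕ, φ^[t] (φ v) = r := by
        constructor
        · rintro ⟨t, ht⟩
          exact ⟨t, by rw [← Function.iterate_succ_apply, Function.iterate_succ_apply', ht, hr]⟩
        · rintro ⟨t, ht⟩
          exact ⟨t + 1, ht⟩
      simp only [Matrix.mulVec, Matrix.of_apply, edgeRow, if_neg hv]
      rw [sub_dotProduct]
      simp [key]

/-- A map leading to `r` admits a depth function decreasing along the map. -/
theorem LeadsTo.exists_depth {φ : V → V} {r : V} (h : LeadsTo φ r) :
    ∃ d : V → ℕ, ∀ v, v ≠ r → d (φ v) < d v := by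
  refine ⟨fun v => Nat.find (h v), fun v hv => ?_⟩
  have hs := Nat.find_spec (h v)
  obtain ⟨m, hm⟩ : ∃ m, Nat.find (h v) = m + 1 :=
    Nat.exists_eq_succ_of_ne_zero fun h0 => hv (by rw [h0] at hs; exact hs)
  rw [hm] at hs
  have : Nat.find (h (φ v)) ≤ m := Nat.find_min' _ hs
  show Nat.find (h (φ v)) < Nat.find (h v)
  omega

theorem det_edgeRow_of_leadsTo [Fintype V] [DecidableEq V]
    {φ : V → V} {r : V} (h : LeadsTo φ r) :
    Matrix.det (Matrix.of fun v => edgeRow r v (φ v)) = 1 := by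
  obtain ⟨d, hd⟩ := h.exists_depth
  have hoff : ∀ v u, u ≠ v → d v ≤ d u → edgeRow r v (φ v) u = 0 := by
    intro v u huv hle
    by_cases hv : v = r
    · subst hv
      simp [edgeRow, huv]
    · have : u ≠ φ v := by
        rintro rfl
        exact absurd (hd v hv) (by omega)
      simp [edgeRow, hv, huv, this]
  have hdiag : ∀ v, edgeRow r v (φ v) v = 1 := by
    intro v
    by_cases hv : v = r
    · subst hv
      simp [edgeRow]
    · have : v ≠ φ v := by
        intro h0
        have := hd v hv
        rw [← h0] at this
        exact lt_irrefl _ this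
      simp [edgeRow, hv, this]
  have hM : (Matrix.of fun v => edgeRow r v (φ v)).BlockTriangular
      fun v => OrderDual.toDual (d v) := by
    intro v u huv
    have huv : d v < d u := huv
    exact hoff v u (by rintro rfl; exact lt_irrefl _ huv) huv.le
  rw [hM.det]
  refine Finset.prod_eq_one fun a _ => ?_
  have h1 : (Matrix.of fun v => edgeRow r v (φ v)).toSquareBlock
      (fun v => OrderDual.toDual (d v)) a = 1 := ?_
  · rw [h1, Matrix.det_one]
  ext ⟨v, hv⟩ ⟨u, hu⟩
  by_cases huv : v = u
  · subst huv
    simp [Matrix.toSquareBlock, Matrix.toSquareBlockProp, hdiag]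
  · have : d v = d u := OrderDual.toDual.injective (hv.trans hu.symm)
    simp [Matrix.toSquareBlock, Matrix.toSquareBlockProp, huv, hoff v u (Ne.symm huv) this.le]

theorem parentGraph_connected {φ : V → V} {r : V} (h : LeadsTo φ r) :
    (parentGraph φ).Connected := by
  have hstep : ∀ v, (parentGraph φ).Reachable v (φ v) := by
    intro v
    by_cases hv : v = φ v
    · rw [← hv]
    · exact SimpleGraph.Adj.reachable (by simp [parentGraph, hv])
  have hall : ∀ (t : ℕ) v, (parentGraph φ).Reachable v (φ^[t] v) := by
    intro t
    induction t with
    | zero => intro v; rfl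
    | succ t ih => intro v; exact (hstep v).trans (ih (φ v))
  rw [SimpleGraph.connected_iff_exists_forall_reachable]
  refine ⟨r, fun v => ?_⟩
  obtain ⟨t, ht⟩ := h v
  have := hall t v
  rw [ht] at this
  exact this.symm

theorem parentGraph_isTree [Fintype V] {φ : V → V} {r : V} (hr : φ r = r) (h : LeadsTo φ r) :
    (parentGraph φ).IsTree := by
  have hc := parentGraph_connected h
  rw [SimpleGraph.isTree_iff_connected_and_card]
  refine ⟨hc, le_antisymm ?_ hc.card_vert_le_card_edgeSet_add_one⟩
  have hsub : (parentGraph φ).edgeSet ⊆ (fun v => s(v, φ v)) '' {v | v ≠ r} := by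
    intro e
    induction e with
    | h u v =>
      intro he
      simp only [parentGraph, SimpleGraph.mem_edgeSet, SimpleGraph.fromRel_adj] at he
      obtain ⟨hne, rfl | rfl⟩ := he
      · exact ⟨u, fun h0 => hne (by rw [h0, hr]), rfl⟩
      · exact ⟨v, fun h0 => hne (by rw [h0, hr]), Sym2.eq_swap⟩
  have h1 : Nat.card (parentGraph φ).edgeSet ≤ Set.ncard {v | v ≠ r} := by
    rw [Nat.card_coe_set_eq]
    exact (Set.ncard_le_ncard hsub (Set.toFinite _)).trans (Set.ncard_image_le (Set.toFinite _))
  have h2 : Set.ncard {v | v ≠ r} + 1 = Nat.card V := by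
    have := Set.ncard_add_ncard_compl {r}
    rw [Set.ncard_singleton] at this
    rw [← this, add_comm]
    rfl
  omega

theorem parentGraph_injective {φ ψ : V → V} {r : V} (hφr : φ r = r) (hψr : ψ r = r)
    (hφ : LeadsTo φ r) (h : parentGraph φ = parentGraph ψ) : φ = ψ := by
  obtain ⟨d, hd⟩ := hφ.exists_depth
  have hφne : ∀ v, v ≠ r → v ≠ φ v := by
    intro v hv h0
    have := hd v hv
    rw [← h0] at this
    exact lt_irrefl _ this
  have hbad : ∀ v, φ v ≠ ψ v → φ (φ v) ≠ ψ (φ v) := by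
    intro v hv
    have hvr : v ≠ r := by
      rintro rfl
      exact hv (hφr.trans hψr.symm)
    have hadj : (parentGraph φ).Adj v (φ v) := by simp [parentGraph, hφne v hvr]
    rw [h] at hadj
    simp only [parentGraph, SimpleGraph.fromRel_adj] at hadj
    obtain ⟨-, h1 | h1⟩ := hadj
    · exact absurd h1.symm hv
    · rw [h1]
      intro h2
      have hwr : φ v ≠ r := by
        intro h3
        rw [h3, hψr] at h1
        exact hvr h1.symm
      have a1 := hd v hvr
      have a2 := hd _ hwr
      rw [h2] at a2
      omega
  funext v
  by_contra hv
  have hall : ∀ t : ℕ, φ (φ^[t] v) ≠ ψ (φ^[t] v) := by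
    intro t
    induction t with
    | zero => exact hv
    | succ t ih => rw [Function.iterate_succ_apply']; exact hbad _ ih
  obtain ⟨t, ht⟩ := hφ v
  apply hall t
  rw [ht, hφr, hψr]

theorem exists_parent_of_isTree {H : SimpleGraph V} (hH : H.IsTree) (r : V) :
    ∃ φ : V → V, φ r = r ∧ (∀ v, v ≠ r → H.Adj v (φ v)) ∧ LeadsTo φ r ∧ parentGraph φ = H := by
  have hstep : ∀ v, ∃ u, (v = r → u = r) ∧ (v ≠ r → H.Adj v u ∧ H.dist u r < H.dist v r) := by
    intro v
    by_cases hv : v = r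
    · exact ⟨r, fun _ => rfl, fun h => absurd hv h⟩
    · obtain ⟨p, hp⟩ := hH.connected.exists_walk_length_eq_dist v r
      cases p with
      | nil => exact absurd rfl hv
      | cons hadj q =>
        refine ⟨_, fun h => absurd h hv, fun _ => ⟨hadj, ?_⟩⟩
        rw [← hp, SimpleGraph.Walk.length_cons]
        exact Nat.lt_succ_of_le (SimpleGraph.dist_le q)
  choose φ h0 h1 using hstep
  have hl : LeadsTo φ r := by
    intro v
    induction hn : H.dist v r using Nat.strong_induction_on generalizing v with
    | _ n ih =>
      by_cases hv : v = r
      · exact ⟨0, hv⟩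
      · obtain ⟨t, ht⟩ := ih _ (hn ▸ (h1 v hv).2) (φ v) rfl
        exact ⟨t + 1, ht⟩
  refine ⟨φ, h0 r rfl, fun v hv => (h1 v hv).1, hl, ?_⟩
  have hle : parentGraph φ ≤ H := by
    intro u v huv
    simp only [parentGraph, SimpleGraph.fromRel_adj] at huv
    obtain ⟨hne, rfl | rfl⟩ := huv
    · exact (h1 u fun h => hne (h.trans (h0 u h).symm)).1
    · exact (h1 v fun h => hne ((h0 v h).trans h.symm)).1.symm
  exact le_antisymm hle
    ((SimpleGraph.isTree_iff_minimal_connected.1 hH).2 (parentGraph_connected hl) hle)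

theorem numSpanningTrees_eq_card [Fintype V] [DecidableEq V]
    (G : SimpleGraph V) [DecidableRel G.Adj] (r : V) :
    numSpanningTrees G = Finset.card {φ ∈ Fintype.piFinset
      (fun v => if v = r then {r} else G.neighborFinset v) | LeadsTo φ r} := by
  have hmem : ∀ φ : V → V, φ ∈ Fintype.piFinset
      (fun v => if v = r then {r} else G.neighborFinset v) ↔
      φ r = r ∧ ∀ v, v ≠ r → G.Adj v (φ v) := by
    intro φ
    rw [Fintype.mem_piFinset]
    constructor
    · intro h
      refine ⟨by simpa using h r, fun v hv => ?_⟩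
      simpa [hv] using h v
    · rintro ⟨h0, h1⟩ v
      by_cases hv : v = r
      · simp [hv, h0]
      · simpa [hv] using h1 v hv
  rw [numSpanningTrees, ← Set.ncard_coe_finset]
  symm
  refine Set.ncard_congr (fun φ _ => parentGraph φ) ?_ ?_ ?_
  · intro φ hφ
    simp only [coe_filter, Set.mem_ofPred_eq, hmem] at hφ
    obtain ⟨⟨h0, h1⟩, h2⟩ := hφ
    refine ⟨?_, parentGraph_isTree h0 h2⟩
    intro u v huv
    simp only [parentGraph, SimpleGraph.fromRel_adj] at huv
    obtain ⟨hne, rfl | rfl⟩ := huv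
    · exact h1 u fun h => hne (by rw [h, h0])
    · exact (h1 v fun h => hne (by rw [h, h0])).symm
  · intro φ ψ hφ hψ h
    simp only [coe_filter, Set.mem_ofPred_eq, hmem] at hφ hψ
    exact parentGraph_injective hφ.1.1 hψ.1.1 hφ.2 h
  · rintro H ⟨hle, hH⟩
    obtain ⟨φ, h0, h1, h2, rfl⟩ := exists_parent_of_isTree hH r
    refine ⟨φ, ?_, rfl⟩
    simp only [coe_filter, Set.mem_ofPred_eq, hmem]
    exact ⟨⟨h0, fun v hv => hle (h1 v hv)⟩, h2⟩

/-- The matrix-tree theorem. -/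
theorem det_updateRow_lapMatrix [Fintype V] [DecidableEq V]
    (G : SimpleGraph V) [DecidableRel G.Adj] (r : V) :
    ((G.lapMatrix ℤ).updateRow r (Pi.single r 1)).det = numSpanningTrees G := by
  have hM : (G.lapMatrix ℤ).updateRow r (Pi.single r 1) = fun v =>
      ∑ u ∈ (if v = r then {r} else G.neighborFinset v), edgeRow r v u := by
    funext v
    by_cases hv : v = r
    · subst hv
      simp [edgeRow]
    · rw [Matrix.updateRow_ne hv]
      ext w
      simp only [hv, if_false, edgeRow, Finset.sum_apply, Pi.sub_apply, Finset.sum_sub_distrib]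
      simp [SimpleGraph.lapMatrix, SimpleGraph.degMatrix, Matrix.diagonal_apply, Pi.single_apply,
        SimpleGraph.adjMatrix_apply, eq_comm]
  have hexp := (Matrix.detRowAlternating (n := V) (R := ℤ)).toMultilinearMap.map_sum_finset
    (fun v u => edgeRow r v u) (fun v => if v = r then {r} else G.neighborFinset v)
  rw [hM]
  refine hexp.trans ?_
  rw [numSpanningTrees_eq_card G r, Finset.card_eq_sum_ones, Finset.sum_filter, Nat.cast_sum]
  refine Finset.sum_congr rfl fun φ hφ => ?_
  have hr : φ r = r := by simpa using Fintype.mem_piFinset.1 hφ r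
  split_ifs with h
  · exact (det_edgeRow_of_leadsTo h).trans (by simp)
  · exact (det_edgeRow_of_not_leadsTo hr h).trans (by simp)

/-- Temperley's form of the matrix-tree theorem. -/
theorem det_lapMatrix_add_one [Fintype V] [DecidableEq V]
    (G : SimpleGraph V) [DecidableRel G.Adj] [Nonempty V] :
    (G.lapMatrix ℤ + Matrix.of fun _ _ => 1).det
      = (Fintype.card V : ℤ) ^ 2 * numSpanningTrees G := by
  obtain ⟨r⟩ := ‹Nonempty V›
  set L := G.lapMatrix ℤ
  have hrow : ∀ v, ∑ u, L v u = 0 := by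
    intro v
    simpa [Matrix.mulVec, dotProduct] using congrFun (G.lapMatrix_mulVec_const_eq_zero (R := ℤ)) v
  have hcol : ∀ u, ∑ v, L v u = 0 := by
    intro u
    rw [← hrow u]
    exact Finset.sum_congr rfl fun v _ => (G.isSymm_lapMatrix ℤ).apply u v
  have h1 : (L + Matrix.of fun _ _ => 1).det
      = (Fintype.card V : ℤ) * ((L + Matrix.of fun _ _ => 1).updateRow r fun _ => 1).det := by
    have := Matrix.det_updateRow_sum (L + Matrix.of fun _ _ => 1) r fun _ => 1
    rw [one_smul] at this
    rw [← this, ← Matrix.det_updateRow_smul]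
    congr 2
    ext u
    refine (Finset.sum_apply u _ _).trans ?_
    simp [Finset.sum_add_distrib, hcol]
  have h2 : ((L + Matrix.of fun _ _ => 1).updateRow r fun _ => 1).det
      = (L.updateRow r fun _ => 1).det := by
    refine Matrix.det_eq_of_forall_row_eq_smul_add_const (fun v => if v = r then 0 else 1) r
      (by simp) fun v u => ?_
    by_cases hv : v = r
    · subst hv
      simp
    · simp [hv]
  have h3 : ∀ j, (L.updateRow r (Pi.single j 1)).det = (L.updateRow r (Pi.single r 1)).det := by
    intro j
    have h0 : (L.updateRow r (Pi.single j 1 - Pi.single r 1)).det = 0 := by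
      rw [← Matrix.exists_mulVec_eq_zero_iff]
      refine ⟨fun _ => 1, fun h => one_ne_zero (congrFun h r), ?_⟩
      ext v
      by_cases hv : v = r
      · subst hv
        simp [Matrix.mulVec, dotProduct]
      · simpa [Matrix.mulVec, hv, dotProduct] using hrow v
    have := Matrix.det_updateRow_add L r (Pi.single j 1 - Pi.single r 1) (Pi.single r 1)
    rwa [sub_add_cancel, h0, zero_add] at this
  have h4 : (L.updateRow r fun _ => 1).det = ∑ j, (L.updateRow r (Pi.single j 1)).det := by
    have := (Matrix.detRowAlternating (n := V) (R := ℤ)).toMultilinearMap.map_update_sum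
      Finset.univ r (fun j => (Pi.single j 1 : V → ℤ)) L
    refine Eq.trans ?_ this
    rw [Finset.univ_sum_single (fun _ : V => (1 : ℤ))]
    rfl
  rw [h1, h2, h4, Finset.sum_congr rfl fun j _ => h3 j, det_updateRow_lapMatrix]
  simp [sq, mul_assoc]

end SpanningTree

namespace ZMod

/-- The determinant of a circulant matrix is the product of its eigenvalues. -/
theorem det_of_sub {N : ℕ} [NeZero N] (c : ZMod N → ℂ) :
    (Matrix.of fun i j => c (i - j)).det = ∏ k : ZMod N, ∑ d, c d * stdAddChar (d * k) := by
  set F : Matrix (ZMod N) (ZMod N) ℂ := Matrix.of fun i k => stdAddChar (-(i * k)) with hF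
  have hdet : F.det ≠ 0 := by
    intro h0
    obtain ⟨v, hv, hFv⟩ := Matrix.exists_mulVec_eq_zero_iff.2 h0
    apply hv
    apply (ZMod.dft (N := N) (E := ℂ)).injective
    rw [map_zero, ← hFv]
    ext k
    simp [dft_apply, Matrix.mulVec, dotProduct, hF, mul_comm k]
  have hmul : (Matrix.of fun i j => c (i - j)) * F =
      F * Matrix.diagonal fun k => ∑ d, c d * stdAddChar (d * k) := by
    ext i k
    rw [Matrix.mul_diagonal, Matrix.mul_apply, Finset.mul_sum,
      ← Equiv.sum_comp (Equiv.subLeft i)]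
    refine Finset.sum_congr rfl fun d _ => ?_
    simp only [hF, Matrix.of_apply, Equiv.subLeft_apply, sub_sub_cancel]
    rw [mul_left_comm, ← AddChar.map_add_eq_mul]
    congr 2
    ring
  have := congrArg Matrix.det hmul
  rw [Matrix.det_mul, Matrix.det_mul, Matrix.det_diagonal, mul_comm] at this
  exact mul_left_cancel₀ hdet this

end ZMod

namespace Polynomial

theorem eq_prod_X_sub_C_of_monic {m : ℕ} {P : ℝ[X]} (hP : P.Monic) (hdeg : P.natDegree = m)
    {r : ℕ → ℝ} (hr : Set.InjOn r (Finset.range m)) (hroot : ∀ i < m, P.eval (r i) = 0) :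
    P = ∏ i ∈ Finset.range m, (X - C (r i)) := by
  refine eq_of_monic_of_dvd_of_natDegree_le (monic_prod_of_monic _ _ fun i _ => monic_X_sub_C (r i))
    hP (Finset.prod_dvd_of_coprime (fun i hi j hj hij => ?_) fun i hi => ?_) ?_
  · exact isCoprime_X_sub_C_of_isUnit_sub (sub_ne_zero.2 fun h => hij (hr hi hj h)).isUnit
  · exact dvd_iff_isRoot.2 (hroot i (Finset.mem_range.1 hi))
  · rw [natDegree_finsetProd_X_sub_C_eq_card, hdeg, Finset.card_range]

/-- The values of an integral polynomial at the roots of a monic integral polynomial multiply to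
the resultant. -/
theorem prod_aeval_eq_resultant {m : ℕ} {P : ℤ[X]} (hP : P.Monic) {r : ℕ → ℝ}
    (hmap : P.map (algebraMap ℤ ℝ) = ∏ i ∈ Finset.range m, (X - C (r i))) (g : ℤ[X]) :
    ∏ i ∈ Finset.range m, aeval (r i) g = ((resultant P g : ℤ) : ℝ) := by
  have hroots : (P.map (algebraMap ℤ ℝ)).roots = (Finset.range m).val.map r := by
    rw [hmap, roots_prod _ _ (Finset.prod_ne_zero_iff.2 fun i _ => X_sub_C_ne_zero (r i))]
    simp
  have hsplit : (P.map (algebraMap ℤ ℝ)).Splits := by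
    rw [hmap]
    exact Splits.prod fun i _ => Splits.X_sub_C _
  have := resultant_eq_prod_eval (P.map (algebraMap ℤ ℝ)) (g.map (algebraMap ℤ ℝ)) g.natDegree
    natDegree_map_le hsplit
  rw [hP.natDegree_map, resultant_map_map, (hP.map _).leadingCoeff, one_pow, one_mul,
    hroots] at this
  rw [← eq_intCast (algebraMap ℤ ℝ), this, Multiset.map_map, Finset.prod]
  exact congrArg _ (Multiset.map_congr rfl fun i _ => (eval_map_algebraMap g (r i)).symm)

namespace Chebyshev

theorem C_succ_monic_natDegree (n : ℕ) :
    (C ℤ (n + 1)).Monic ∧ (C ℤ (n + 1)).natDegree = n + 1 := by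
  induction n using Nat.strong_induction_on with
  | _ n ih =>
    match n with
    | 0 => simp [monic_X]
    | 1 =>
      have : (1 : ℤ) + 1 = 2 := rfl
      simp only [Nat.cast_one, this, C_two]
      have h2 : (X ^ 2 - 2 : ℤ[X]) = X ^ 2 - Polynomial.C 2 := rfl
      rw [h2]
      exact ⟨monic_X_pow_sub_C 2 two_ne_zero, natDegree_X_pow_sub_C⟩
    | n + 2 =>
      obtain ⟨h1, d1⟩ := ih (n + 1) (by omega)
      obtain ⟨h0, d0⟩ := ih n (by omega)
      have hrec := C_add_two ℤ ((n : ℤ) + 1)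
      have e1 : ((n + 2 : ℕ) : ℤ) + 1 = (n : ℤ) + 1 + 2 := by push_cast; ring
      have e2 : ((n + 1 : ℕ) : ℤ) + 1 = (n : ℤ) + 1 + 1 := by push_cast; ring
      rw [e2] at h1 d1
      have hm : (X * C ℤ ((n : ℤ) + 1 + 1)).Monic := monic_X.mul h1
      have hd : (X * C ℤ ((n : ℤ) + 1 + 1)).natDegree = n + 3 := by
        rw [monic_X.natDegree_mul h1, d1, natDegree_X]; omega
      have hlt : (C ℤ ((n : ℤ) + 1)).degree < (X * C ℤ ((n : ℤ) + 1 + 1)).degree := by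
        apply degree_lt_degree; omega
      rw [e1, hrec]
      refine ⟨hm.sub_of_left hlt, ?_⟩
      rw [natDegree_sub_eq_left_of_natDegree_lt (by omega), hd]

theorem C_monic_natDegree {n : ℕ} (hn : 0 < n) : (C ℤ n).Monic ∧ (C ℤ n).natDegree = n := by
  obtain ⟨l, rfl⟩ : ∃ l, n = l + 1 := ⟨n - 1, by omega⟩
  simpa using C_succ_monic_natDegree l

theorem S_monic_natDegree (n : ℕ) : (S ℤ n).Monic ∧ (S ℤ n).natDegree = n := by
  induction n using Nat.strong_induction_on with
  | _ n ih =>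
    match n with
    | 0 => simp
    | 1 => simp [monic_X]
    | n + 2 =>
      obtain ⟨h1, d1⟩ := ih (n + 1) (by omega)
      obtain ⟨h0, d0⟩ := ih n (by omega)
      have hrec := S_add_two ℤ (n : ℤ)
      have e1 : ((n + 2 : ℕ) : ℤ) = (n : ℤ) + 2 := by push_cast; ring
      have e2 : ((n + 1 : ℕ) : ℤ) = (n : ℤ) + 1 := by push_cast; ring
      rw [e2] at h1 d1
      have hm : (X * S ℤ ((n : ℤ) + 1)).Monic := monic_X.mul h1
      have hd : (X * S ℤ ((n : ℤ) + 1)).natDegree = n + 2 := by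
        rw [monic_X.natDegree_mul h1, d1, natDegree_X]; omega
      have hlt : (S ℤ (n : ℤ)).degree < (X * S ℤ ((n : ℤ) + 1)).degree := by
        apply degree_lt_degree; omega
      rw [e1, hrec]
      refine ⟨hm.sub_of_left hlt, ?_⟩
      rw [natDegree_sub_eq_left_of_natDegree_lt (by omega), hd]

theorem even_eval_zero_C (n : ℕ) : Even ((C ℤ n).eval 0) := by
  induction n using Nat.strong_induction_on with
  | _ n ih =>
    match n with
    | 0 => simp
    | 1 => simp
    | n + 2 =>
      have e1 : ((n + 2 : ℕ) : ℤ) = (n : ℤ) + 2 := by push_cast; ring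
      rw [e1, C_add_two]
      simpa using ih n (by omega)

theorem aeval_C_two_mul_cos (n : ℤ) (θ : ℝ) :
    aeval (2 * Real.cos θ) (C ℤ n) = 2 * Real.cos (n * θ) := by
  rw [← C_two_mul_real_cos, ← eval_map_algebraMap, map_C]

theorem injOn_two_mul_cos {m : ℕ} {θ : ℕ → ℝ} (h0 : ∀ i < m, 0 ≤ θ i ∧ θ i ≤ Real.pi)
    (hinj : Set.InjOn θ (Finset.range m)) :
    Set.InjOn (fun i => 2 * Real.cos (θ i)) (Finset.range m) := by
  intro i hi j hj hij
  apply hinj hi hj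
  have hi' := h0 i (by simpa using hi)
  have hj' := h0 j (by simpa using hj)
  exact Real.injOn_cos hi' hj' (mul_left_cancel₀ two_ne_zero hij)

theorem C_eq_prod {m : ℕ} (hm : 0 < m) : (C ℝ m) = ∏ i ∈ Finset.range m,
    (X - Polynomial.C (2 * Real.cos ((2 * i + 1) * Real.pi / (2 * m)))) := by
  have hm' : (0 : ℝ) < m := by exact_mod_cast hm
  have hπ := Real.pi_pos
  have hC := C_monic_natDegree hm
  rw [← map_C (algebraMap ℤ ℝ)]
  refine eq_prod_X_sub_C_of_monic (hC.1.map _) ((hC.1.natDegree_map _).trans hC.2) ?_ ?_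
  · refine injOn_two_mul_cos (θ := fun i : ℕ => (2 * i + 1) * Real.pi / (2 * m)) ?_ ?_
    · intro i hi
      refine ⟨by positivity, ?_⟩
      rw [div_le_iff₀ (by positivity), mul_comm Real.pi]
      gcongr
      exact_mod_cast (by omega : 2 * i + 1 ≤ 2 * m)
    · intro i _ j _ hij
      field_simp at hij
      exact_mod_cast (by linarith : (i : ℝ) = j)
  · intro i _
    rw [map_C, C_two_mul_real_cos]
    have : ((m : ℤ) : ℝ) * ((2 * i + 1) * Real.pi / (2 * m)) = (2 * (i : ℤ) + 1) * Real.pi / 2 := by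
      push_cast
      field_simp
    rw [this, mul_eq_zero]
    right
    exact Real.cos_eq_zero_iff.2 ⟨i, rfl⟩

theorem S_eq_prod (m : ℕ) : (S ℝ m) = ∏ i ∈ Finset.range m,
    (X - Polynomial.C (2 * Real.cos ((i + 1) * Real.pi / (m + 1)))) := by
  have hπ := Real.pi_pos
  have hS := S_monic_natDegree m
  rw [← map_S (algebraMap ℤ ℝ)]
  refine eq_prod_X_sub_C_of_monic (hS.1.map _) ((hS.1.natDegree_map _).trans hS.2) ?_ ?_
  · refine injOn_two_mul_cos (θ := fun i : ℕ => (i + 1) * Real.pi / (m + 1)) ?_ ?_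
    · intro i hi
      refine ⟨by positivity, ?_⟩
      rw [div_le_iff₀ (by positivity), mul_comm Real.pi]
      gcongr
    · intro i _ j _ hij
      field_simp at hij
      exact_mod_cast (by linarith : (i : ℝ) = j)
  · intro i hi
    have h := S_two_mul_real_cos ((i + 1) * Real.pi / (m + 1)) m
    have : (((m : ℕ) : ℤ) + 1 : ℝ) * ((i + 1) * Real.pi / (m + 1)) = ((i + 1 : ℕ) : ℝ) * Real.pi := by
      push_cast
      field_simp
    rw [this, Real.sin_nat_mul_pi] at h
    rw [map_S]
    refine (mul_eq_zero.1 h).resolve_right (Real.sin_pos_of_pos_of_lt_pi (by positivity) ?_).ne'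
    rw [div_lt_iff₀ (by positivity), mul_comm Real.pi]
    gcongr

theorem prod_aeval_roots_C {m : ℕ} (hm : 0 < m) (g : ℤ[X]) :
    ∏ i ∈ Finset.range m, aeval (2 * Real.cos ((2 * i + 1) * Real.pi / (2 * m))) g
      = ((resultant (C ℤ m) g : ℤ) : ℝ) :=
  prod_aeval_eq_resultant (C_monic_natDegree hm).1 ((map_C _ _).trans (C_eq_prod hm)) g

theorem prod_aeval_roots_S (m : ℕ) (g : ℤ[X]) :
    ∏ i ∈ Finset.range m, aeval (2 * Real.cos ((i + 1) * Real.pi / (m + 1))) g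
      = ((resultant (S ℤ m) g : ℤ) : ℝ) :=
  prod_aeval_eq_resultant (S_monic_natDegree m).1 ((map_S _ _).trans (S_eq_prod m)) g

theorem prod_two_sub_roots_S (m : ℕ) :
    ∏ i ∈ Finset.range m, (2 - 2 * Real.cos ((i + 1) * Real.pi / (m + 1))) = m + 1 := by
  have := congrArg (eval 2) (S_eq_prod m)
  rw [S_eval_two, eval_prod] at this
  simpa using this.symm

end Chebyshev

theorem even_resultant_of_even_eval_zero {f g : ℤ[X]} (hdeg : f.natDegree ≠ 0)
    (hf : Even (f.eval 0)) (hg : Even (g.eval 0)) : Even (resultant f g) := by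
  obtain ⟨p, q, -, -, h⟩ := exists_mul_add_mul_eq_C_resultant f g le_rfl le_rfl (Or.inl hdeg)
  have := congrArg (eval 0) h
  rw [eval_C, eval_add, eval_mul, eval_mul] at this
  rw [← this]
  exact (hf.mul_right _).add (hg.mul_right _)

end Polynomial

namespace CirculantOdd

variable {n k : ℕ} {s : Fin k → ℕ}

/-- The first row of the adjacency matrix of `circulantOdd n s`. -/
def adjSymbol (n : ℕ) (s : Fin k → ℕ) (d : ZMod (2 * n)) : ℤ :=
  ∑ i, ((if d = (s i : ZMod (2 * n)) then 1 else 0) + if d = -(s i : ZMod (2 * n)) then 1 else 0)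
    + if d = (n : ZMod (2 * n)) then 1 else 0

theorem ite_adj_eq [NeZero (2 * n)] (hmono : StrictMono s) (h1 : ∀ j, 1 ≤ s j)
    (h2 : ∀ j, s j < n) (u v : ZMod (2 * n)) :
    (if (circulantOdd n s).Adj u v then (1 : ℤ) else 0) = adjSymbol n s (u - v) := by
  have hn : 0 < n := by have := NeZero.ne (2 * n); omega
  obtain ⟨t, ht, hd⟩ : ∃ t < 2 * n, u - v = (t : ZMod (2 * n)) :=
    ⟨(u - v).val, ZMod.val_lt _, (ZMod.natCast_zmod_val _).symm⟩
  have hcast : ∀ a b : ℕ, a < 2 * n → b < 2 * n → ((a : ZMod (2 * n)) = b ↔ a = b) := by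
    intro a b ha hb
    rw [ZMod.natCast_eq_natCast_iff', Nat.mod_eq_of_lt ha, Nat.mod_eq_of_lt hb]
  have hneg : ∀ a b : ℕ, a < 2 * n → 0 < b → b < 2 * n →
      ((a : ZMod (2 * n)) = -(b : ZMod (2 * n)) ↔ a + b = 2 * n) := by
    intro a b ha hb hb'
    rw [eq_neg_iff_add_eq_zero, ← Nat.cast_add, ZMod.natCast_eq_zero_iff]
    constructor
    · rintro ⟨c, hc⟩
      have : c < 2 := by
        by_contra h
        have : 2 * n * 2 ≤ 2 * n * c := Nat.mul_le_mul_left _ (by omega)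
        omega
      interval_cases c <;> omega
    · intro h; rw [h]
  have hneg' : ∀ b : ℕ, v - u = (b : ZMod (2 * n)) ↔ u - v = -(b : ZMod (2 * n)) := by
    intro b
    rw [← neg_sub u v, neg_eq_iff_eq_neg]
  have hne : u ≠ v ↔ t ≠ 0 := by
    rw [← sub_ne_zero, hd, ne_eq, ne_eq, ← Nat.cast_zero, hcast t 0 ht (by omega)]
  have e1 : ∀ i, u - v = (s i : ZMod (2 * n)) ↔ t = s i := fun i => by
    rw [hd, hcast _ _ ht (by have := h2 i; omega)]
  have e2 : ∀ i, u - v = -(s i : ZMod (2 * n)) ↔ t + s i = 2 * n := fun i => by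
    rw [hd, hneg _ _ ht (h1 i) (by have := h2 i; omega)]
  have e3 : u - v = (n : ZMod (2 * n)) ↔ t = n := by rw [hd, hcast _ _ ht (by omega)]
  have e4 : u - v = -(n : ZMod (2 * n)) ↔ t = n := by
    rw [hd, hneg _ _ ht hn (by omega)]; omega
  have hadj : (circulantOdd n s).Adj u v ↔ (∃ i, t = s i) ∨ (∃ i, t + s i = 2 * n) ∨ t = n := by
    rw [circulantOdd, SimpleGraph.circulantGraph_adj, ← ne_eq, hne]
    simp only [Set.mem_union, Set.mem_ofPred_eq, Set.mem_singleton_iff, hneg', e1, e2, e3, e4]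
    have : (∃ i, t = s i) → t ≠ 0 := by rintro ⟨i, rfl⟩; have := h1 i; omega
    have : (∃ i, t + s i = 2 * n) → t ≠ 0 := by rintro ⟨i, hi⟩; have := h2 i; omega
    have : t = n → t ≠ 0 := by omega
    tauto
  have hs1 : ∑ i, (if t = s i then (1 : ℤ) else 0) = if ∃ i, t = s i then 1 else 0 := by
    split_ifs with h
    · obtain ⟨j, hj⟩ := h
      simp [hj, hmono.injective.eq_iff]
    · push Not at h
      simp [h]
  have hs2 : ∑ i, (if t + s i = 2 * n then (1 : ℤ) else 0)
      = if ∃ i, t + s i = 2 * n then 1 else 0 := by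
    split_ifs with h
    · obtain ⟨j, hj⟩ := h
      simp [← hj, hmono.injective.eq_iff]
    · push Not at h
      simp [h]
  simp only [adjSymbol, hadj, e1, e2, e3, Finset.sum_add_distrib, hs1, hs2]
  have d1 : (∃ i, t = s i) → t < n := by rintro ⟨i, rfl⟩; exact h2 i
  have d2 : (∃ i, t + s i = 2 * n) → n < t := by rintro ⟨i, hi⟩; have := h2 i; omega
  by_cases c1 : ∃ i, t = s i
  · have c2 : ¬ ∃ i, t + s i = 2 * n := fun h => by have := d1 c1; have := d2 h; omega
    have c3 : t ≠ n := (d1 c1).ne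
    simp only [c1, c2, c3]; simp
  · by_cases c2 : ∃ i, t + s i = 2 * n
    · have c3 : t ≠ n := (d2 c2).ne'
      simp only [c1, c2, c3]; simp
    · simp only [c1, c2]; simp

theorem sum_adjSymbol [NeZero (2 * n)] : ∑ d, adjSymbol n s d = 2 * k + 1 := by
  simp only [adjSymbol, Finset.sum_add_distrib]
  rw [Finset.sum_comm, Finset.sum_comm (γ := ZMod (2 * n))]
  simp
  ring

theorem lapMatrix_add_one [NeZero (2 * n)] (hmono : StrictMono s) (h1 : ∀ j, 1 ≤ s j)
    (h2 : ∀ j, s j < n) :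
    (circulantOdd n s).lapMatrix ℤ + Matrix.of (fun _ _ => 1) = Matrix.of fun u v =>
      (if u - v = 0 then 2 * (k : ℤ) + 1 else 0) - adjSymbol n s (u - v) + 1 := by
  ext u v
  have hdeg : ((circulantOdd n s).degree u : ℤ) = 2 * k + 1 := by
    rw [SimpleGraph.degree_eq_sum_if_adj, ← sum_adjSymbol (n := n) (s := s),
      ← Equiv.sum_comp (Equiv.subLeft u)]
    refine Finset.sum_congr rfl fun v _ => ?_
    rw [ite_adj_eq hmono h1 h2]
    simp
  simp only [SimpleGraph.lapMatrix, SimpleGraph.degMatrix, Matrix.add_apply, Matrix.sub_apply,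
    Matrix.diagonal_apply, SimpleGraph.adjMatrix_apply, Matrix.of_apply, hdeg, sub_eq_zero,
    ← ite_adj_eq hmono h1 h2]

/-- The Laplacian eigenvalue of `circulantOdd n s` at the `t`-th character. -/
noncomputable def eigenvalue (n : ℕ) (s : Fin k → ℕ) (t : ℕ) : ℝ :=
  2 * k + 1 - ∑ i, 2 * Real.cos (s i * (t * Real.pi / n)) - Real.cos (t * Real.pi)

theorem stdAddChar_natCast [NeZero (2 * n)] (a : ℕ) :
    ZMod.stdAddChar (a : ZMod (2 * n)) = Complex.exp ((a * Real.pi / n : ℝ) * Complex.I) := by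
  have hn : (n : ℂ) ≠ 0 := by
    have := NeZero.ne (2 * n)
    exact_mod_cast (by omega : n ≠ 0)
  have := ZMod.stdAddChar_coe (N := 2 * n) (a : ℤ)
  rw [Int.cast_natCast] at this
  rw [this]
  congr 1
  push_cast
  field_simp

theorem stdAddChar_add_neg [NeZero (2 * n)] (a : ℕ) :
    ZMod.stdAddChar (a : ZMod (2 * n)) + ZMod.stdAddChar (-(a : ZMod (2 * n)))
      = ((2 * Real.cos (a * Real.pi / n) : ℝ) : ℂ) := by
  rw [AddChar.map_neg_eq_inv, stdAddChar_natCast, ← Complex.exp_neg, ← neg_mul]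
  rw [Complex.ofReal_mul, Complex.ofReal_cos, Complex.ofReal_ofNat, Complex.two_cos]

theorem stdAddChar_mul_self [NeZero (2 * n)] (t : ℕ) :
    ZMod.stdAddChar ((n * t : ℕ) : ZMod (2 * n)) = (Real.cos (t * Real.pi) : ℂ) := by
  have hn : (n : ℝ) ≠ 0 := by
    have := NeZero.ne (2 * n)
    exact_mod_cast (by omega : n ≠ 0)
  rw [stdAddChar_natCast]
  have : (((n * t : ℕ) : ℝ) * Real.pi / n) = t * Real.pi := by
    push_cast
    field_simp
  rw [this, Complex.exp_ofReal_mul_I, Real.sin_nat_mul_pi]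
  simp

theorem sum_symbol_mul_char [NeZero (2 * n)] (t : ℕ) :
    ∑ d, (((if d = 0 then 2 * (k : ℤ) + 1 else 0) - adjSymbol n s d : ℤ) : ℂ) *
      ZMod.stdAddChar (d * (t : ZMod (2 * n))) = (eigenvalue n s t : ℂ) := by
  have key : ∀ e : ZMod (2 * n), ∑ d, ((if d = e then (1 : ℂ) else 0)) *
      ZMod.stdAddChar (d * (t : ZMod (2 * n))) = ZMod.stdAddChar (e * (t : ZMod (2 * n))) := by
    intro e; simp
  have h0 : ∑ d, ((if d = 0 then 2 * (k : ℂ) + 1 else 0)) *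
      ZMod.stdAddChar (d * (t : ZMod (2 * n))) = 2 * k + 1 := by simp
  simp only [adjSymbol]
  push_cast
  simp only [sub_mul, add_mul, Finset.sum_mul, Finset.sum_sub_distrib, Finset.sum_add_distrib]
  rw [h0, key, Finset.sum_comm, Finset.sum_comm (γ := ZMod (2 * n))]
  simp only [key]
  rw [← Finset.sum_add_distrib, ← Nat.cast_mul, stdAddChar_mul_self, eigenvalue]
  push_cast
  rw [sub_sub]
  congr 2
  refine Finset.sum_congr rfl fun i _ => ?_
  rw [neg_mul, ← Nat.cast_mul, stdAddChar_add_neg]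
  push_cast
  rw [mul_assoc, mul_div_assoc]

theorem prod_zmod_eq_prod_range {N : ℕ} [NeZero N] {M : Type*} [CommMonoid M] (g : ZMod N → M) :
    ∏ x, g x = ∏ t ∈ Finset.range N, g t := by
  refine Finset.prod_nbij' ZMod.val (fun t => (t : ZMod N)) ?_ ?_ ?_ ?_ ?_
  · intro x _
    simpa using ZMod.val_lt x
  · simp
  · simp
  · intro t ht
    exact ZMod.val_cast_of_lt (Finset.mem_range.1 ht)
  · simp

theorem det_eq_prod [NeZero (2 * n)] (hmono : StrictMono s) (h1 : ∀ j, 1 ≤ s j)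
    (h2 : ∀ j, s j < n) :
    (((circulantOdd n s).lapMatrix ℤ + Matrix.of fun _ _ => 1).det : ℝ)
      = 2 * n * ∏ t ∈ Finset.range (2 * n - 1), eigenvalue n s (t + 1) := by
  have hn := NeZero.ne (2 * n)
  apply Complex.ofReal_injective
  rw [lapMatrix_add_one hmono h1 h2, Complex.ofReal_intCast, ← eq_intCast (Int.castRingHom ℂ),
    RingHom.map_det]
  refine (ZMod.det_of_sub fun d => ((((if d = 0 then 2 * (k : ℤ) + 1 else 0)
    - adjSymbol n s d + 1 : ℤ)) : ℂ)).trans ?_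
  rw [prod_zmod_eq_prod_range]
  have hval : ∀ t : ℕ, ∑ d, ((((if d = 0 then 2 * (k : ℤ) + 1 else 0)
      - adjSymbol n s d + 1 : ℤ)) : ℂ) * ZMod.stdAddChar (d * (t : ZMod (2 * n)))
      = eigenvalue n s t + if (t : ZMod (2 * n)) = 0 then (2 * n : ℂ) else 0 := by
    intro t
    have hprim := AddChar.sum_mulShift (t : ZMod (2 * n)) (ZMod.isPrimitive_stdAddChar (2 * n))
    simp only [Int.cast_add _ (1 : ℤ), add_mul, Finset.sum_add_distrib, Int.cast_one, one_mul]
    rw [sum_symbol_mul_char, hprim, ZMod.card]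
    push_cast
    rfl
  simp only [hval]
  have hrange : Finset.range (2 * n) = Finset.range (2 * n - 1 + 1) := by
    rw [Nat.sub_add_cancel (by omega)]
  rw [hrange, Finset.prod_range_succ']
  have hz : eigenvalue n s 0 = 0 := by simp [eigenvalue, mul_comm]
  have hnz : ∀ t ∈ Finset.range (2 * n - 1), ((t + 1 : ℕ) : ZMod (2 * n)) ≠ 0 := by
    intro t ht h
    rw [ZMod.natCast_eq_zero_iff] at h
    have := Nat.le_of_dvd (by omega) h
    have := Finset.mem_range.1 ht
    omega
  rw [Finset.prod_congr rfl fun t ht => by rw [if_neg (hnz t ht), add_zero], hz]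
  push_cast
  simp [mul_comm]

theorem eigenvalue_reflect (hn : 0 < n) {t : ℕ} (ht : t ≤ 2 * n) :
    eigenvalue n s (2 * n - t) = eigenvalue n s t := by
  have hn' : (n : ℝ) ≠ 0 := by exact_mod_cast hn.ne'
  unfold eigenvalue
  rw [Nat.cast_sub ht]
  congr 1
  · congr 1
    refine Finset.sum_congr rfl fun i _ => ?_
    rw [show (s i : ℝ) * (((2 * n : ℕ) - t : ℝ) * Real.pi / n)
      = (s i : ℕ) * (2 * Real.pi) - s i * (t * Real.pi / n) by push_cast; field_simp,
      Real.cos_nat_mul_two_pi_sub]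
  · rw [show (((2 * n : ℕ) - t : ℝ) * Real.pi) = (n : ℕ) * (2 * Real.pi) - t * Real.pi by
      push_cast; ring, Real.cos_nat_mul_two_pi_sub]

theorem eigenvalue_self (hn : 0 < n) (heven : Even n) :
    eigenvalue n s n = 4 * (Finset.univ.filter fun j => Odd (s j)).card := by
  have hn' : (n : ℝ) ≠ 0 := by exact_mod_cast hn.ne'
  have hterm : ∀ i, 2 * Real.cos (s i * (n * Real.pi / n))
      = 2 - 4 * (if Odd (s i) then 1 else 0) := by
    intro i
    rw [mul_div_cancel_left₀ _ hn', Real.cos_nat_mul_pi]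
    split_ifs with h
    · rw [h.neg_one_pow]; norm_num
    · rw [(Nat.not_odd_iff_even.1 h).neg_one_pow]; norm_num
  simp only [eigenvalue, hterm, Finset.sum_sub_distrib, ← Finset.mul_sum, Finset.sum_boole,
    Real.cos_nat_mul_pi, heven.neg_one_pow]
  simp
  ring

theorem prod_eigenvalue (hn : 0 < n) (heven : Even n) :
    ∏ t ∈ Finset.range (2 * n - 1), eigenvalue n s (t + 1)
      = 4 * (Finset.univ.filter fun j => Odd (s j)).card
        * (∏ t ∈ Finset.range (n - 1), eigenvalue n s (t + 1)) ^ 2 := by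
  rw [show 2 * n - 1 = (n - 1 + 1) + (n - 1) by omega, Finset.prod_range_add,
    Finset.prod_range_succ, Nat.sub_add_cancel hn, eigenvalue_self hn heven,
    ← Finset.prod_range_reflect (fun t => eigenvalue n s (n + t + 1))]
  rw [Finset.prod_congr rfl fun t ht => ?_]
  · rw [sq]; ring
  · have := Finset.mem_range.1 ht
    rw [← eigenvalue_reflect hn (by omega)]
    congr 1
    omega

/-- The polynomial whose value at `2 cos θ` is the even part of the Laplacian symbol. -/
noncomputable def symbolPoly (s : Fin k → ℕ) : ℤ[X] := 2 * (k : ℤ[X]) - ∑ i, Chebyshev.C ℤ (s i)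

theorem aeval_symbolPoly (s : Fin k → ℕ) (θ : ℝ) :
    aeval (2 * Real.cos θ) (symbolPoly s) = 2 * k - ∑ i, 2 * Real.cos (s i * θ) := by
  simp only [symbolPoly, map_sub, map_mul, map_sum, map_natCast, map_ofNat]
  congr 1
  refine Finset.sum_congr rfl fun i _ => ?_
  rw [Chebyshev.aeval_C_two_mul_cos, Int.cast_natCast]

theorem eigenvalue_odd {m i : ℕ} : eigenvalue (2 * m) s (2 * i + 1)
    = aeval (2 * Real.cos ((2 * i + 1) * Real.pi / (2 * m))) (symbolPoly s + 2) := by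
  rw [map_add, aeval_symbolPoly, map_ofNat, eigenvalue, Real.cos_nat_mul_pi,
    Odd.neg_one_pow ⟨i, rfl⟩]
  push_cast
  ring

theorem eigenvalue_even {l i : ℕ} : eigenvalue (2 * (l + 1)) s (2 * i + 2)
    = aeval (2 * Real.cos ((i + 1) * Real.pi / (l + 1))) (symbolPoly s) := by
  rw [aeval_symbolPoly, eigenvalue, Real.cos_nat_mul_pi, Even.neg_one_pow ⟨i + 1, by ring⟩]
  have : ((2 * i + 2 : ℕ) * Real.pi / (2 * (l + 1) : ℕ) : ℝ) = (i + 1) * Real.pi / (l + 1) := by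
    have : (l + 1 : ℝ) ≠ 0 := by positivity
    push_cast
    field_simp
  rw [this]
  ring

theorem prod_range_odd_even (f : ℕ → ℝ) (l : ℕ) : ∏ t ∈ Finset.range (2 * l + 1), f (t + 1)
    = (∏ i ∈ Finset.range (l + 1), f (2 * i + 1)) * ∏ i ∈ Finset.range l, f (2 * i + 2) := by
  induction l with
  | zero => simp
  | succ l ih =>
    rw [show 2 * (l + 1) + 1 = 2 * l + 1 + 1 + 1 by ring, Finset.prod_range_succ,
      Finset.prod_range_succ, ih, Finset.prod_range_succ (fun i => f (2 * i + 1)) (l + 1),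
      Finset.prod_range_succ (fun i => f (2 * i + 2)) l]
    ring_nf

theorem exists_prod_eigenvalue_eq (hn : 0 < n) (heven : Even n) :
    ∃ b : ℤ, ∏ t ∈ Finset.range (n - 1), eigenvalue n s (t + 1) = n * b := by
  obtain ⟨l, rfl⟩ : ∃ l, n = 2 * (l + 1) := by
    obtain ⟨m, rfl⟩ := heven
    exact ⟨m - 1, by omega⟩
  obtain ⟨g, hg⟩ : (X - Polynomial.C 2) ∣ symbolPoly s := by
    rw [dvd_iff_isRoot, IsRoot, symbolPoly, eval_sub, eval_finsetSum]
    simp [mul_comm]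
  have hC := Chebyshev.C_monic_natDegree (Nat.succ_pos l)
  have hsymbol : Even ((symbolPoly s + 2).eval 0) := by
    rw [symbolPoly, eval_add, eval_sub, eval_finsetSum]
    refine Even.add (Even.sub (by simp) (Finset.even_sum _ fun i _ => ?_)) (by simp)
    exact Chebyshev.even_eval_zero_C _
  obtain ⟨c, hc⟩ := even_resultant_of_even_eval_zero (by rw [hC.2]; omega)
    (Chebyshev.even_eval_zero_C (l + 1)) hsymbol
  refine ⟨c * resultant (Chebyshev.S ℤ l) (-g), ?_⟩
  have hodd := Chebyshev.prod_aeval_roots_C (Nat.succ_pos l) (symbolPoly s + 2)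
  have hevenProd := Chebyshev.prod_aeval_roots_S l (-g)
  have hfac : ∀ w : ℝ, aeval w (symbolPoly s) = (2 - w) * aeval w (-g) := by
    intro w
    rw [hg, map_neg, map_mul, map_sub, aeval_X, aeval_C]
    simp
    ring
  rw [show 2 * (l + 1) - 1 = 2 * l + 1 by omega, prod_range_odd_even]
  simp only [eigenvalue_odd, eigenvalue_even, hfac]
  rw [Finset.prod_mul_distrib, Chebyshev.prod_two_sub_roots_S, hevenProd]
  rw [Nat.succ_eq_add_one] at hodd
  rw [hodd, hc]
  push_cast
  ring

theorem exists_numSpanningTrees_eq (hn : 0 < n) (heven : Even n) (hmono : StrictMono s)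
    (h1 : ∀ j, 1 ≤ s j) (h2 : ∀ j, s j < n) :
    ∃ b : ℤ, (numSpanningTrees (circulantOdd n s) : ℤ)
      = 2 * (Finset.univ.filter fun j => Odd (s j)).card * n * b ^ 2 := by
  have : NeZero (2 * n) := ⟨by omega⟩
  obtain ⟨b, hb⟩ := exists_prod_eigenvalue_eq (s := s) hn heven
  refine ⟨b, ?_⟩
  have h := det_eq_prod hmono h1 h2
  rw [SpanningTree.det_lapMatrix_add_one, prod_eigenvalue hn heven, hb, ZMod.card] at h
  have hn' : (n : ℝ) ≠ 0 := by exact_mod_cast hn.ne'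
  have h4 : (4 * n ^ 2 : ℝ) ≠ 0 := by positivity
  push_cast at h
  have : ((numSpanningTrees (circulantOdd n s) : ℤ) : ℝ)
      = ((2 * (Finset.univ.filter fun j => Odd (s j)).card * n * b ^ 2 : ℤ) : ℝ) := by
    apply mul_left_cancel₀ h4
    push_cast
    linear_combination h
  exact_mod_cast this

end CirculantOdd

/-- for even `n`, if `p ≥ 1` is the number of odd elements among `s_1,…,s_k`
and `q` is the square-free part of `2p` (i.e. `q` squarefree with `2p = q x²`, `x ≥ 1`),
then the number of spanning trees of `C_{2n}(s_1,…,s_k,n)` equals `q · n · a²` for some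
integer `a`. -/
theorem statement14 (n k : ℕ) (heven : Even n) (hn : 2 ≤ n) (hk : 0 < k) (s : Fin k → ℕ)
    (hmono : StrictMono s) (h1 : ∀ j, 1 ≤ s j) (h2 : ∀ j, s j < n)
    (hgcd : Nat.gcd (Finset.univ.gcd s) n = 1)
    (hp : 1 ≤ (Finset.univ.filter fun j => Odd (s j)).card)
    (q x : ℕ) (hq : Squarefree q) (hx : 0 < x)
    (hpqx : 2 * (Finset.univ.filter fun j => Odd (s j)).card = q * x ^ 2) :
    ∃ a : ℕ, numSpanningTrees (circulantOdd n s) = q * n * a ^ 2 := by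
  obtain ⟨b, hb⟩ := CirculantOdd.exists_numSpanningTrees_eq (by omega) heven hmono h1 h2
  refine ⟨x * b.natAbs, ?_⟩
  zify at hpqx ⊢
  rw [hb, mul_pow, sq_abs, hpqx]
  ring
end
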